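/- arXiv:1804.00940 — 6 statements merged into one kernel-verified Lean document; each statement's English description precedes it below -/
import Mathlib

section
/- Let (A, m) be a Cohen–Macaulay local ring of dimension d > 0 and M a parameter module in a finite free A-module F of rank r > 0. Then widetilde(R(M))^S = R(M), where S = Sym_A(F); in particular, M is Ratliff–Rush closed, i.e., tilde(M) = M. -/
set_option maxHeartbeats 1000000
set_option synthInstance.maxHeartbeats 400000

open MvPolynomial IsLocalRing

/-- The embedding of the free module `A^r` onto the degree-one part of the
polynomial ring `Sym_A(A^r) = A[t_1, ..., t_r]`, sending `f` to `∑ i, f i • X i`. -/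
noncomputable abbrev emb (A : Type) [CommRing A] (r : ℕ) :
    (Fin r → A) →ₗ[A] MvPolynomial (Fin r) A :=
  Fintype.linearCombination A MvPolynomial.X

/-- The image `F₁` of the free module `F = A^r` inside `S = Sym_A(F)`. -/
noncomputable def freeSub (A : Type) [CommRing A] (r : ℕ) :
    Submodule A (MvPolynomial (Fin r) A) :=
  Submodule.map (emb A r) ⊤

/-- The image `M₁` of a submodule `M ⊆ F` inside `S = Sym_A(F)`. -/
noncomputable def sub1 (A : Type) [CommRing A] (r : ℕ) (M : Submodule A (Fin r → A)) :
    Submodule A (MvPolynomial (Fin r) A) :=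
  M.map (emb A r)

/-- The Rees algebra `R(M)` of `M ⊆ F`, i.e. the `A`-subalgebra of `S = Sym_A(F)`
generated by the degree-one part `M₁`; its `n`-th homogeneous component is `M₁ ^ n`. -/
noncomputable abbrev reesAlg (A : Type) [CommRing A] (r : ℕ) (M : Submodule A (Fin r → A)) :
    Subalgebra A (MvPolynomial (Fin r) A) :=
  Algebra.adjoin A (sub1 A r M : Set (MvPolynomial (Fin r) A))

/-- The Ratliff--Rush closure `⋃_{ℓ > 0} [N^{ℓ+1} :_{Fn} N^ℓ]` of `N` (inside `Fn`),
where all powers and quotients of submodules are taken inside `S = Sym_A(F)`. -/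
noncomputable def ratliffRush (A : Type) [CommRing A] (r : ℕ)
    (Fn N : Submodule A (MvPolynomial (Fin r) A)) : Submodule A (MvPolynomial (Fin r) A) :=
  ⨆ ℓ : ℕ, (Fn ⊓ (N ^ (ℓ + 2) / N ^ (ℓ + 1)))

/-- The positive part `R₊ = ker(constant term)` of a graded subalgebra `R₀ ⊆ S`. -/
noncomputable def posPart (A : Type) [CommRing A] (r : ℕ)
    (R0 : Subalgebra A (MvPolynomial (Fin r) A)) : Ideal ↥R0 :=
  RingHom.ker ((MvPolynomial.constantCoeff).comp R0.val.toRingHom)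

/-- `widetilde{R₀} = ε⁻¹(H⁰_{R₀₊}(S/R₀))`, i.e., the set of `x ∈ S` annihilated into `R₀`
by a power of the irrelevant ideal `R₀₊`; a graded subring of `S` containing `R₀`. -/
noncomputable def rrAlg (A : Type) [CommRing A] (r : ℕ)
    (R0 : Subalgebra A (MvPolynomial (Fin r) A)) : Subalgebra A (MvPolynomial (Fin r) A) where
  carrier := {x | ∃ m : ℕ, ∀ y ∈ (posPart A r R0) ^ m,
    (y : MvPolynomial (Fin r) A) * x ∈ R0}
  mul_mem' := by
    rintro x₁ x₂ ⟨m₁, h₁⟩ ⟨m₂, h₂⟩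
    refine ⟨m₁ + m₂, fun y hy => ?_⟩
    rw [pow_add] at hy
    refine Submodule.mul_induction_on hy (fun p hp q hq => ?_) (fun a b ha hb => ?_)
    · have : ((p * q : ↥R0) : MvPolynomial (Fin r) A) * (x₁ * x₂)
          = ((p : MvPolynomial (Fin r) A) * x₁) * ((q : MvPolynomial (Fin r) A) * x₂) := by
        push_cast; ring
      rw [this]
      exact mul_mem (h₁ p hp) (h₂ q hq)
    · have : ((a + b : ↥R0) : MvPolynomial (Fin r) A) * (x₁ * x₂)
          = (a : MvPolynomial (Fin r) A) * (x₁ * x₂)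
            + (b : MvPolynomial (Fin r) A) * (x₁ * x₂) := by
        push_cast; ring
      rw [this]
      exact add_mem ha hb
  one_mem' := ⟨0, fun y _ => by rw [mul_one]; exact y.2⟩
  add_mem' := by
    rintro x₁ x₂ ⟨m₁, h₁⟩ ⟨m₂, h₂⟩
    refine ⟨m₁ + m₂, fun y hy => ?_⟩
    rw [mul_add]
    exact add_mem (h₁ y (Ideal.pow_le_pow_right (Nat.le_add_right _ _) hy))
      (h₂ y (Ideal.pow_le_pow_right (Nat.le_add_left _ _) hy))
  zero_mem' := ⟨0, fun y _ => by simpa using R0.zero_mem⟩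
  algebraMap_mem' := fun a =>
    ⟨0, fun y _ => mul_mem y.2 (R0.algebraMap_mem a)⟩

/-- The integral closure of the Rees algebra `R(M)` inside `S = Sym_A(F)`,
viewed as an `A`-subalgebra of `S`. -/
noncomputable def intClAlg (A : Type) [CommRing A] (r : ℕ) (M : Submodule A (Fin r → A)) :
    Subalgebra A (MvPolynomial (Fin r) A) :=
  (integralClosure (↥(reesAlg A r M)) (MvPolynomial (Fin r) A)).restrictScalars A

/-- The integral closure `overline{M^n}`: the `n`-th homogeneous component of the
integral closure of `R(M)` in `S`. -/
noncomputable def barPow (A : Type) [CommRing A] (r : ℕ) (M : Submodule A (Fin r → A))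
    (n : ℕ) : Submodule A (MvPolynomial (Fin r) A) :=
  (freeSub A r) ^ n ⊓ (Subalgebra.toSubmodule (intClAlg A r M))

/-- `M` is a faithful `A`-module. -/
def faithfulSub (A : Type) [CommRing A] (r : ℕ) (M : Submodule A (Fin r → A)) : Prop :=
  ∀ a : A, (∀ x ∈ M, a • x = (0 : Fin r → A)) → a = 0

/-- The length of an `A`-module, as the Krull dimension of its lattice of submodules. -/
noncomputable def modLength (A : Type) [CommRing A] (N : Type) [AddCommGroup N]
    [Module A N] : WithBot ℕ∞ :=
  Order.krullDim (Submodule A N)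

/-- The quotient module `P/N` of two submodules of `S`. -/
abbrev quotNP (A : Type) [CommRing A] (r : ℕ)
    (N P : Submodule A (MvPolynomial (Fin r) A)) :=
  ↥P ⧸ (N.comap P.subtype)

/-- The minimal number of generators of a submodule. -/
noncomputable def minGen (A : Type) [CommRing A] {V : Type} [AddCommGroup V] [Module A V]
    (N : Submodule A V) : ℕ :=
  sInf {n : ℕ | ∃ f : Fin n → V, Submodule.span A (Set.range f) = N}

/-- A Noetherian local ring is Cohen--Macaulay if its depth equals its Krull dimension,
i.e. there is a regular sequence in the maximal ideal whose length is the dimension. -/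
def IsCohenMacaulayLocalRing (R : Type) [CommRing R] [IsLocalRing R] : Prop :=
  ∃ rs : List R, (∀ x ∈ rs, x ∈ maximalIdeal R) ∧
    RingTheory.Sequence.IsRegular R rs ∧ (rs.length : WithBot ℕ∞) = ringKrullDim R

/-- A Noetherian local ring is Buchsbaum (in the sense of Stückrad--Vogel) if every
system of parameters `x_1, …, x_d` is a weak sequence:
`(x_1, …, x_{i-1}) : x_i ⊆ (x_1, …, x_{i-1}) : 𝔪` for all `i`. -/
def IsBuchsbaumLocalRing (R : Type) [CommRing R] [IsLocalRing R] : Prop :=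
  ∀ d : ℕ, ringKrullDim R = d →
    ∀ x : Fin d → R, (∀ i, x i ∈ maximalIdeal R) →
      maximalIdeal R ≤ (Ideal.span (Set.range x)).radical →
      ∀ i : Fin d,
        (Ideal.span (x '' {j | j < i})).colon (Ideal.span {x i}) ≤
          (Ideal.span (x '' {j | j < i})).colon (maximalIdeal R)

/-- An ideal `P` of a graded subalgebra `R₀ ⊆ S` is graded (homogeneous) if it contains,
together with any element, all of its homogeneous components. -/
def IsGradedIdeal (A : Type) [CommRing A] (r : ℕ)
    (R0 : Subalgebra A (MvPolynomial (Fin r) A)) (P : Ideal ↥R0) : Prop :=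
  ∀ x : ↥R0, x ∈ P → ∀ n : ℕ,
    ∀ h : MvPolynomial.homogeneousComponent n (x : MvPolynomial (Fin r) A) ∈ R0,
      (⟨_, h⟩ : ↥R0) ∈ P

/-- The graded maximal ideal `𝔐 = 𝔪 R(M) + R(M)₊` of the Rees algebra, i.e. the
preimage of the maximal ideal under the degree-zero projection. -/
noncomputable abbrev gradedMax (A : Type) [CommRing A] [IsLocalRing A] (r : ℕ)
    (M : Submodule A (Fin r → A)) : Ideal ↥(reesAlg A r M) :=
  Ideal.comap ((MvPolynomial.constantCoeff).comp (reesAlg A r M).val.toRingHom)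
    (maximalIdeal A)




section DepthPart
open CategoryTheory Abelian RingTheory.Sequence Pointwise

/-- Ext-depth predicate: `Ext^i(R/I, Y) = 0` for `i < k`. -/
def DP {R : Type} [CommRing R] (I : Ideal R) (k : ℕ) (Y : Type) [AddCommGroup Y] [Module R Y] :
    Prop :=
  ∀ i < k, ∀ x : Ext (ModuleCat.of R (R ⧸ I)) (ModuleCat.of R Y) i, x = 0

variable {R : Type} [CommRing R] {I : Ideal R} {k : ℕ}
  {Y Y' Y'' : Type} [AddCommGroup Y] [Module R Y] [AddCommGroup Y'] [Module R Y']
  [AddCommGroup Y''] [Module R Y'']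

lemma DP.mono {l : ℕ} (h : DP I k Y) (hl : l ≤ k) : DP I l Y :=
  fun i hi => h i (lt_of_lt_of_le hi hl)

lemma DP.retract (h : DP I k Y) (f : Y' →ₗ[R] Y) (g : Y →ₗ[R] Y') (hgf : ∀ y, g (f y) = y) :
    DP I k Y' := by
  intro i hi x
  have h1 : (ModuleCat.ofHom f) ≫ (ModuleCat.ofHom g) = 𝟙 _ := by
    ext y; exact hgf y
  have h2 := h i hi (x.comp (Ext.mk₀ (ModuleCat.ofHom f)) (add_zero i))
  have h3 : (x.comp (Ext.mk₀ (ModuleCat.ofHom f)) (add_zero i)).comp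
      (Ext.mk₀ (ModuleCat.ofHom g)) (add_zero i) = x := by
    rw [Ext.comp_assoc_of_third_deg_zero, Ext.mk₀_comp_mk₀, h1, Ext.comp_mk₀_id]
  rw [← h3, h2, Ext.zero_comp]

lemma DP.equiv (h : DP I k Y) (e : Y ≃ₗ[R] Y') : DP I k Y' :=
  h.retract e.symm.toLinearMap e.toLinearMap (by simp)

lemma DP.of_subsingleton [Subsingleton Y] : DP I k Y := by
  intro i hi x
  have h1 : (𝟙 (ModuleCat.of R Y)) = 0 := by
    ext y; exact Subsingleton.elim (α := Y) _ _
  rw [← Ext.comp_mk₀_id x, h1, Ext.mk₀_zero, Ext.comp_zero]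

lemma DP.pi (h : DP I k Y) (ι : Type) [Fintype ι] : DP I k (ι → Y) := by
  classical
  intro i hi x
  have h1 : (𝟙 (ModuleCat.of R (ι → Y))) =
     ∑ j : ι, (ModuleCat.ofHom (LinearMap.proj j : (ι → Y) →ₗ[R] Y)) ≫
        (ModuleCat.ofHom (LinearMap.single R (fun _ : ι => Y) j)) := by
    refine ModuleCat.hom_ext (LinearMap.ext fun y => ?_)
    simp only [ModuleCat.hom_sum, ModuleCat.hom_id, ModuleCat.hom_comp, ModuleCat.hom_ofHom,
      LinearMap.sum_apply, LinearMap.comp_apply, LinearMap.proj_apply, LinearMap.id_apply]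
    exact (LinearMap.sum_single_apply _ y).symm
  rw [← Ext.comp_mk₀_id x, h1, Ext.mk₀_sum, Ext.comp_sum]
  refine Finset.sum_eq_zero fun j _ => ?_
  rw [← Ext.mk₀_comp_mk₀, ← Ext.comp_assoc_of_third_deg_zero,
    h i hi (x.comp (Ext.mk₀ (ModuleCat.ofHom (LinearMap.proj j : (ι → Y) →ₗ[R] Y))) (add_zero i)),
    Ext.zero_comp]

lemma shortExact_of (f : Y' →ₗ[R] Y) (g : Y →ₗ[R] Y'') (hf : Function.Injective f)
    (hg : Function.Surjective g) (hfg : Function.Exact f g) :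
    ∃ w, (ShortComplex.mk (ModuleCat.ofHom f) (ModuleCat.ofHom g) w).ShortExact := by
  refine ⟨by ext y; exact hfg.apply_apply_eq_zero y, ?_⟩
  refine
    { exact := (ShortComplex.ShortExact.moduleCat_exact_iff_function_exact _).mpr hfg
      mono_f := (ModuleCat.mono_iff_injective _).mpr hf
      epi_g := (ModuleCat.epi_iff_surjective _).mpr hg }

lemma DP.ses (f : Y' →ₗ[R] Y) (g : Y →ₗ[R] Y'') (hf : Function.Injective f)
    (hg : Function.Surjective g) (hfg : Function.Exact f g)
    (h1 : DP I (k + 1) Y') (h2 : DP I k Y) : DP I k Y'' := by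
  obtain ⟨w, hS⟩ := shortExact_of f g hf hg hfg
  intro i hi x
  obtain ⟨y, hy⟩ := Ext.covariant_sequence_exact₃ _ hS x rfl (h1 (i+1) (by omega) _)
  rw [← hy, h2 i hi y, Ext.zero_comp]

lemma DP.one (h : DP I 1 Y) (y : Y) (hy : ∀ u ∈ I, u • y = 0) : y = 0 := by
  let f : (R ⧸ I) →ₗ[R] Y := Submodule.liftQ I (LinearMap.toSpanSingleton R Y y) (by
    intro u hu; simpa using hy u hu)
  have h1 := h 0 (by omega) (Ext.mk₀ (ModuleCat.ofHom f))
  rw [Ext.mk₀_eq_zero_iff] at h1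
  have h2 : f (Submodule.Quotient.mk 1) = 0 := by
    have := congrArg (fun z => z.hom (Submodule.Quotient.mk (p := I) 1)) h1
    exact this
  rw [Submodule.liftQ_apply] at h2
  simpa using h2

lemma DP.of_one (h : ∀ y : Y, (∀ u ∈ I, u • y = 0) → y = 0) : DP I 1 Y := by
  intro i hi x
  obtain rfl : i = 0 := by omega
  obtain ⟨f, rfl⟩ := Ext.mk₀_bijective _ _ |>.2 x
  rw [Ext.mk₀_eq_zero_iff]
  refine ModuleCat.hom_ext (LinearMap.ext fun z => ?_)
  refine h _ fun u hu => ?_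
  obtain ⟨z, rfl⟩ := Submodule.Quotient.mk_surjective _ z
  rw [← map_smul, ← Submodule.Quotient.mk_smul, (Submodule.Quotient.mk_eq_zero I).2]
  · exact map_zero f.hom
  · exact I.mul_mem_right _ hu

lemma DP.of_isSMulRegular (u : R) (hu : u ∈ I) (hreg : IsSMulRegular Y u)
    (h : DP I k (QuotSMulTop u Y)) : DP I (k + 1) Y := by
  obtain ⟨w, hS⟩ := shortExact_of (LinearMap.lsmul R Y u) (Submodule.mkQ (u • (⊤ : Submodule R Y)))
    hreg (Submodule.mkQ_surjective _) (by
      intro y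
      simp only [Submodule.mkQ_apply, Submodule.Quotient.mk_eq_zero,
        Submodule.mem_smul_pointwise_iff_exists, Submodule.mem_top, true_and, Set.mem_range]
      rfl)
  intro i hi x
  have h0 : u • (𝟙 (ModuleCat.of R (R ⧸ I))) = 0 := by
    refine ModuleCat.hom_ext (LinearMap.ext fun z => ?_)
    obtain ⟨z, rfl⟩ := Submodule.Quotient.mk_surjective _ z
    show u • (Submodule.Quotient.mk z : R ⧸ I) = 0
    rw [← Submodule.Quotient.mk_smul, Submodule.Quotient.mk_eq_zero]
    exact I.mul_mem_right _ hu
  have h1 : u • x = 0 := by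
    conv_lhs => rw [← Ext.mk₀_id_comp x]
    rw [← Ext.smul_comp, ← Ext.mk₀_smul, h0, Ext.mk₀_zero, Ext.zero_comp]
  have h2 : x.comp (Ext.mk₀ (ModuleCat.ofHom (LinearMap.lsmul R Y u))) (add_zero i) = 0 := by
    have h3 : ModuleCat.ofHom (LinearMap.lsmul R Y u) = u • 𝟙 (ModuleCat.of R Y) := by
      ext y; rfl
    rw [h3, Ext.mk₀_smul, Ext.comp_smul, Ext.comp_mk₀_id, h1]
  cases i with
  | zero =>
    obtain ⟨f, rfl⟩ := Ext.mk₀_bijective _ _ |>.2 x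
    rw [Ext.mk₀_comp_mk₀, Ext.mk₀_eq_zero_iff] at h2
    rw [Ext.mk₀_eq_zero_iff]
    refine ModuleCat.hom_ext (LinearMap.ext fun z => ?_)
    have := congrArg (fun g => g.hom z) h2
    exact hreg (this.trans (smul_zero u).symm)
  | succ j =>
    obtain ⟨y, hy⟩ := Ext.covariant_sequence_exact₁ _ hS x h2 rfl
    rw [← hy, h j (by omega) y, Ext.zero_comp]

lemma DP.of_regular (rs : List R) : ∀ (Y : Type) [AddCommGroup Y] [Module R Y],
    (∀ u ∈ rs, u ∈ I) → IsWeaklyRegular Y rs → DP I rs.length Y := by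
  induction rs with
  | nil => intro Y _ _ _ _ i hi; simp at hi
  | cons u rs ih =>
    intro Y _ _ hI h
    rw [isWeaklyRegular_cons_iff] at h
    exact DP.of_isSMulRegular u (hI u (by simp)) h.1 (ih _ (fun v hv => hI v (by simp [hv])) h.2)

end DepthPart


section Exterior
variable {R : Type} [CommRing R] {n : ℕ} {W : Type} [AddCommGroup W] [Module R W]

/-- fermionic sign -/
def fsgn {n : ℕ} (j : Fin n) (S : Finset (Fin n)) : ℤ := (-1) ^ (S.filter (· < j)).card

lemma fsgn_sq (j : Fin n) (S : Finset (Fin n)) : fsgn j S * fsgn j S = 1 := by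
  rw [fsgn, ← pow_add, ← two_mul, pow_mul]; simp

lemma fsgn_insert (i j : Fin n) (S : Finset (Fin n)) (hi : i ∉ S) :
    fsgn j (insert i S) = if i < j then - fsgn j S else fsgn j S := by
  unfold fsgn
  rw [Finset.filter_insert]
  split_ifs with h
  · rw [Finset.card_insert_of_notMem (by simp [hi]), pow_succ]; ring
  · rfl

lemma fsgn_erase (i j : Fin n) (S : Finset (Fin n)) (hi : i ∈ S) :
    fsgn j (S.erase i) = if i < j then - fsgn j S else fsgn j S := by
  have := fsgn_insert i j (S.erase i) (by simp)
  rw [Finset.insert_erase hi] at this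
  rw [this]
  split_ifs <;> simp

variable (R W) in
/-- annihilation operator -/
def fann (j : Fin n) : (Finset (Fin n) → W) →ₗ[R] (Finset (Fin n) → W) where
  toFun x S := if j ∈ S then 0 else fsgn j S • x (insert j S)
  map_add' x y := by ext S; simp only [Pi.add_apply]; split_ifs <;> simp
  map_smul' c x := by
    ext S; simp only [Pi.smul_apply, RingHom.id_apply]; split_ifs
    · simp
    · rw [smul_comm]

variable (R W) in
/-- creation operator -/
def fcre (j : Fin n) : (Finset (Fin n) → W) →ₗ[R] (Finset (Fin n) → W) where
  toFun x S := if j ∈ S then fsgn j S • x (S.erase j) else 0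
  map_add' x y := by ext S; simp only [Pi.add_apply]; split_ifs <;> simp
  map_smul' c x := by
    ext S; simp only [Pi.smul_apply, RingHom.id_apply]; split_ifs
    · rw [smul_comm]
    · simp

lemma fann_apply (j : Fin n) (x : Finset (Fin n) → W) (S : Finset (Fin n)) :
    fann R W j x S = if j ∈ S then 0 else fsgn j S • x (insert j S) := rfl

lemma fcre_apply (j : Fin n) (x : Finset (Fin n) → W) (S : Finset (Fin n)) :
    fcre R W j x S = if j ∈ S then fsgn j S • x (S.erase j) else 0 := rfl

lemma fann_fann_self (j : Fin n) (x : Finset (Fin n) → W) :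
    fann R W j (fann R W j x) = 0 := by
  ext S; simp [fann_apply]

lemma fann_fann (i j : Fin n) (x : Finset (Fin n) → W) :
    fann R W i (fann R W j x) = - fann R W j (fann R W i x) := by
  ext S
  rcases eq_or_ne i j with rfl | hij
  · simp [fann_fann_self]
  · rw [Pi.neg_apply, fann_apply, fann_apply]
    by_cases hi : i ∈ S
    · simp [hi, fann_apply]
    · by_cases hj : j ∈ S
      · simp [hj, fann_apply]
      · rw [fann_apply, fann_apply]
        simp only [hi, hj, if_false, Finset.mem_insert, hij, hij.symm, or_self]
        rw [fsgn_insert i j S hi, fsgn_insert j i S hj, Finset.insert_comm, smul_smul, smul_smul,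
          ← neg_smul]
        congr 1
        rcases lt_or_gt_of_ne hij with h | h
        · simp [h, h.not_gt, mul_comm]
        · simp [h, h.not_gt, mul_comm]

lemma fann_fcre_self (j : Fin n) (x : Finset (Fin n) → W) :
    fann R W j (fcre R W j x) + fcre R W j (fann R W j x) = x := by
  ext S
  rw [Pi.add_apply, fann_apply j (fcre R W j x), fcre_apply j (fann R W j x)]
  by_cases hj : j ∈ S
  · rw [if_pos hj, if_pos hj, fann_apply j x, if_neg (by simp), smul_smul, Finset.insert_erase hj,
      fsgn_erase _ _ _ hj]
    simp [fsgn_sq]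
  · rw [if_neg hj, if_neg hj, fcre_apply, if_pos (by simp), smul_smul, Finset.erase_insert hj,
      fsgn_insert _ _ _ hj]
    simp [fsgn_sq]

lemma fann_fcre (i j : Fin n) (hij : i ≠ j) (x : Finset (Fin n) → W) :
    fann R W i (fcre R W j x) + fcre R W j (fann R W i x) = 0 := by
  ext S
  rw [Pi.add_apply, fann_apply i (fcre R W j x), fcre_apply j (fann R W i x)]
  by_cases hi : i ∈ S
  · simp [hi, fann_apply, hij]
  · by_cases hj : j ∈ S
    · rw [if_neg hi, if_pos hj, fcre_apply, fann_apply, if_pos (by simp [hj]),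
        if_neg (by simp [hi]), smul_smul, smul_smul, fsgn_insert _ _ _ hi, fsgn_erase _ _ _ hj,
        Finset.erase_insert_of_ne hij, ← add_smul, Pi.zero_apply]
      convert zero_smul ℤ _
      rcases lt_or_gt_of_ne hij with h | h
      · simp [h, h.not_gt, mul_comm]
      · simp [h, h.not_gt, mul_comm]
    · simp [hj, hi, fcre_apply, hij.symm]

variable (W) in
/-- contraction with a row -/
def ctr (φ : Fin n → R) : (Finset (Fin n) → W) →ₗ[R] (Finset (Fin n) → W) :=
  ∑ j, φ j • fann R W j

variable (W) in
/-- wedge with a column -/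
def wdg (c : Fin n → R) : (Finset (Fin n) → W) →ₗ[R] (Finset (Fin n) → W) :=
  ∑ j, c j • fcre R W j

lemma ctr_apply (φ : Fin n → R) (x : Finset (Fin n) → W) :
    ctr W φ x = ∑ j, φ j • fann R W j x := by simp [ctr]

lemma wdg_apply (φ : Fin n → R) (x : Finset (Fin n) → W) :
    wdg W φ x = ∑ j, φ j • fcre R W j x := by simp [wdg]

lemma ctr_ctr (φ ψ : Fin n → R) (x : Finset (Fin n) → W) :
    ctr W φ (ctr W ψ x) = - ctr W ψ (ctr W φ x) := by
  simp only [ctr_apply, map_sum, Finset.smul_sum, map_smul]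
  rw [Finset.sum_comm, ← Finset.sum_neg_distrib]
  refine Finset.sum_congr rfl fun j _ => ?_
  rw [← Finset.sum_neg_distrib]
  refine Finset.sum_congr rfl fun i _ => ?_
  rw [fann_fann i j, smul_neg, smul_neg, smul_comm, neg_neg]

lemma ctr_self (φ : Fin n → R) (x : Finset (Fin n) → W) :
    ctr W φ (ctr W φ x) = 0 := by
  simp only [ctr_apply, map_sum, Finset.smul_sum, map_smul]
  rw [← Finset.sum_product']
  refine Finset.sum_involution (fun p _ => p.swap) ?_ ?_ ?_ ?_
  · rintro ⟨i, j⟩ -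
    simp only [Prod.fst_swap, Prod.snd_swap]
    rw [fann_fann i j, smul_neg, smul_neg, smul_comm]
    simp
  · rintro ⟨i, j⟩ - h h'
    simp only [Prod.swap_prod_mk, Prod.mk.injEq] at h'
    obtain ⟨rfl, -⟩ := h'
    exact h (by simp [fann_fann_self])
  · simp
  · simp

lemma ctr_wdg (φ c : Fin n → R) (x : Finset (Fin n) → W) :
    ctr W φ (wdg W c x) = (∑ j, φ j * c j) • x - wdg W c (ctr W φ x) := by
  rw [eq_sub_iff_add_eq]
  simp only [ctr_apply, wdg_apply, map_sum, Finset.smul_sum, map_smul]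
  rw [Finset.sum_comm, ← Finset.sum_add_distrib, Finset.sum_smul]
  refine Finset.sum_congr rfl fun j _ => ?_
  rw [← Finset.sum_add_distrib, Finset.sum_eq_single j]
  · rw [smul_comm, ← smul_add, ← smul_add, fann_fcre_self, smul_smul, mul_comm]
  · intro i _ hi
    rw [smul_comm, ← smul_add, ← smul_add, fann_fcre j i hi.symm, smul_zero, smul_zero]
  · simp

variable (R W n) in
/-- degree `m` part -/
def Lsub (m : ℕ) : Submodule R (Finset (Fin n) → W) where
  carrier := {x | ∀ S, S.card ≠ m → x S = 0}
  add_mem' hx hy S hS := by simp [hx S hS, hy S hS]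
  zero_mem' S _ := rfl
  smul_mem' c x hx S hS := by simp [hx S hS]

lemma mem_Lsub {m : ℕ} {x : Finset (Fin n) → W} :
    x ∈ Lsub R n W m ↔ ∀ S, S.card ≠ m → x S = 0 := Iff.rfl

lemma Lsub_eq_bot {m : ℕ} (hm : n < m) : Lsub R n W m = ⊥ := by
  rw [eq_bot_iff]
  intro x hx
  ext S
  refine hx S ?_
  have := S.card_le_univ
  simp at this
  omega

lemma ctr_mem {m : ℕ} (φ : Fin n → R) {x : Finset (Fin n) → W} (hx : x ∈ Lsub R n W (m + 1)) :
    ctr W φ x ∈ Lsub R n W m := by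
  rw [ctr_apply]
  refine Submodule.sum_mem _ fun j _ => Submodule.smul_mem _ _ ?_
  intro S hS
  rw [fann_apply]
  split_ifs with h
  · rfl
  · rw [hx _ (by rw [Finset.card_insert_of_notMem h]; omega), smul_zero]

lemma wdg_mem {m : ℕ} (φ : Fin n → R) {x : Finset (Fin n) → W} (hx : x ∈ Lsub R n W m) :
    wdg W φ x ∈ Lsub R n W (m + 1) := by
  rw [wdg_apply]
  refine Submodule.sum_mem _ fun j _ => Submodule.smul_mem _ _ ?_
  intro S hS
  rw [fcre_apply]
  split_ifs with h
  · rw [hx _ (by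
      have := Finset.card_pos.2 ⟨j, h⟩
      rw [Finset.card_erase_of_mem h]; omega), smul_zero]
  · rfl

lemma DP.Lsub {I : Ideal R} {k : ℕ} (h : DP I k W) (m : ℕ) : DP I k (Lsub R n W m) := by
  refine (h.pi (Finset (Fin n))).retract (Submodule.subtype _)
    { toFun := fun x => ⟨fun S => if S.card = m then x S else 0, by
        intro S hS; simp [hS]⟩
      map_add' := by
        intro x y; ext S; simp only [Pi.add_apply, Submodule.coe_add]; split_ifs <;> simp
      map_smul' := by
        intro c y; ext S
        simp only [Pi.smul_apply, Submodule.coe_smul, RingHom.id_apply]; split_ifs <;> simp } ?_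
  intro y
  ext S
  by_cases hS : S.card = m
  · simp [hS]
  · simp [hS, y.2 S hS]

variable (W) in
/-- boundaries from the first `q` rows in degree `m` -/
def Zsub (ψ : ℕ → Fin n → R) : ℕ → ℕ → Submodule R (Finset (Fin n) → W)
  | 0, _ => ⊥
  | q + 1, m => Zsub ψ q m ⊔ (Lsub R n W (m + 1)).map (ctr W (ψ q))

lemma mem_Zsub_succ {ψ : ℕ → Fin n → R} {q m : ℕ} {x : Finset (Fin n) → W} :
    x ∈ Zsub W ψ (q + 1) m ↔
      ∃ z ∈ Zsub W ψ q m, ∃ y ∈ Lsub R n W (m + 1), z + ctr W (ψ q) y = x := by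
  rw [Zsub, Submodule.mem_sup]
  constructor
  · rintro ⟨z, hz, _, ⟨y, hy, rfl⟩, h⟩
    exact ⟨z, hz, y, hy, h⟩
  · rintro ⟨z, hz, y, hy, h⟩
    exact ⟨z, hz, _, ⟨y, hy, rfl⟩, h⟩

lemma Zsub_le_Lsub (ψ : ℕ → Fin n → R) (q m : ℕ) : Zsub W ψ q m ≤ Lsub R n W m := by
  induction q with
  | zero => exact bot_le
  | succ q ih =>
    refine sup_le ih ?_
    rintro _ ⟨y, hy, rfl⟩
    exact ctr_mem _ hy

lemma ctr_Zsub (ψ : ℕ → Fin n → R) (φ : Fin n → R) (q m : ℕ) {x : Finset (Fin n) → W}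
    (hx : x ∈ Zsub W ψ q (m + 1)) : ctr W φ x ∈ Zsub W ψ q m := by
  induction q generalizing x with
  | zero =>
    have : x = 0 := hx
    simp [this]
  | succ q ih =>
    obtain ⟨z, hz, y, hy, rfl⟩ := mem_Zsub_succ.1 hx
    refine mem_Zsub_succ.2 ⟨_, ih hz, - ctr W φ y, Submodule.neg_mem _ (ctr_mem _ hy), ?_⟩
    rw [map_add, map_neg, ← ctr_ctr]

lemma ctr_Zsub_succ (ψ : ℕ → Fin n → R) (q m : ℕ) {x : Finset (Fin n) → W}
    (hx : x ∈ Zsub W ψ (q + 1) (m + 1)) : ctr W (ψ q) x ∈ Zsub W ψ q m := by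
  obtain ⟨z, hz, y, hy, rfl⟩ := mem_Zsub_succ.1 hx
  rw [map_add, ctr_self, add_zero]
  exact ctr_Zsub _ _ _ _ hz

/-- One-step torsion, auxiliary. -/
lemma wdg_Zsub (ψ : ℕ → Fin n → R) (c : Fin n → R) (q m : ℕ)
    (hc : ∀ i < q, ∑ j, ψ i j * c j = 0) {x : Finset (Fin n) → W}
    (hx : x ∈ Zsub W ψ q m) : wdg W c x ∈ Zsub W ψ q (m + 1) := by
  induction q generalizing x with
  | zero =>
    have : x = 0 := hx
    simp [this]
  | succ q ih =>
    obtain ⟨z, hz, y, hy, rfl⟩ := mem_Zsub_succ.1 hx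
    refine mem_Zsub_succ.2 ⟨_, ih (fun i hi => hc i (by omega)) hz, - wdg W c y,
      Submodule.neg_mem _ (wdg_mem _ hy), ?_⟩
    rw [map_add, map_neg, ctr_wdg, hc q (by omega)]
    simp

/-- One-step torsion. -/
lemma one_step (ψ : ℕ → Fin n → R) (c : Fin n → R) (q m : ℕ)
    (hc : ∀ i < q, ∑ j, ψ i j * c j = 0) {x : Finset (Fin n) → W}
    (hxL : x ∈ Lsub R n W (m + 1))
    (hx : ctr W (ψ q) x ∈ Zsub W ψ q m) :
    (∑ j, ψ q j * c j) • x ∈ Zsub W ψ (q + 1) (m + 1) := by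
  refine mem_Zsub_succ.2 ⟨_, wdg_Zsub ψ c q m hc hx, wdg W c x, wdg_mem _ hxL, ?_⟩
  rw [ctr_wdg]; abel

variable (W) in
/-- iterated contraction -/
def Del (ψ : ℕ → Fin n → R) : ℕ → (Finset (Fin n) → W) →ₗ[R] (Finset (Fin n) → W)
  | 0 => LinearMap.id
  | k + 1 => (ctr W (ψ k)).comp (Del ψ k)

lemma Del_succ (ψ : ℕ → Fin n → R) (k : ℕ) (x : Finset (Fin n) → W) :
    Del W ψ (k + 1) x = ctr W (ψ k) (Del W ψ k x) := rfl

lemma Del_ctr (ψ : ℕ → Fin n → R) (φ : Fin n → R) (k : ℕ) (x : Finset (Fin n) → W) :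
    Del W ψ k (ctr W φ x) = (-1 : ℤ) ^ k • ctr W φ (Del W ψ k x) := by
  induction k with
  | zero => simp [Del]
  | succ k ih => rw [Del_succ, ih, Del_succ, map_zsmul, ctr_ctr, pow_succ]; simp

lemma Del_mem (ψ : ℕ → Fin n → R) (k m : ℕ) {x : Finset (Fin n) → W}
    (hx : x ∈ Lsub R n W (m + k)) : Del W ψ k x ∈ Lsub R n W m := by
  induction k generalizing m with
  | zero => exact hx
  | succ k ih => exact ctr_mem _ (ih (m + 1) (by rwa [show m + 1 + k = m + (k + 1) by ring]))

lemma Del_Zsub (ψ : ℕ → Fin n → R) (k m : ℕ) {x : Finset (Fin n) → W}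
    (hx : x ∈ Zsub W ψ k m) : Del W ψ k x = 0 := by
  induction k generalizing x with
  | zero => exact hx
  | succ k ih =>
    obtain ⟨z, hz, y, hy, rfl⟩ := mem_Zsub_succ.1 hx
    rw [Del_succ, map_add, ih hz, Del_ctr, zero_add, map_zsmul, ctr_self, smul_zero]

/-- splice (a) -/
lemma splice_a (ψ c : ℕ → Fin n → R) (k m : ℕ)
    (hc : ∀ q < k, ∀ i < q, ∑ j, ψ i j * c q j = 0) {x : Finset (Fin n) → W}
    (hxL : x ∈ Lsub R n W (m + k)) (hx : Del W ψ k x = 0) :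
    (∏ q ∈ Finset.range k, ∑ j, ψ q j * c q j) • x ∈ Zsub W ψ k (m + k) := by
  induction k generalizing x with
  | zero =>
    have : x = 0 := hx
    simp [this]
  | succ k ih =>
    have h1 : Del W ψ k (ctr W (ψ k) x) = 0 := by
      rw [Del_ctr, ← Del_succ, hx, smul_zero]
    have h2 := ih (fun q hq => hc q (by omega)) (ctr_mem (ψ k) hxL) h1
    rw [← map_smul] at h2
    have h3 := one_step ψ (c k) k (m + k) (hc k (by omega)) (Submodule.smul_mem _ _ hxL) h2
    rw [Finset.prod_range_succ, mul_comm, mul_smul]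
    exact h3

/-- splice (b) -/
lemma splice_b (ψ c : ℕ → Fin n → R) (k m : ℕ)
    (hc : ∀ q < k, ∀ i < q, ∑ j, ψ i j * c q j = 0) {x : Finset (Fin n) → W}
    (hxL : x ∈ Lsub R n W m) (hx : ∀ i < k, ctr W (ψ i) x = 0) :
    ∃ z ∈ Lsub R n W (m + k), Del W ψ k z = (∏ q ∈ Finset.range k, ∑ j, ψ q j * c q j) • x := by
  induction k generalizing x m with
  | zero => exact ⟨x, hxL, by simp [Del]⟩
  | succ k ih =>
    obtain ⟨z, hz, h⟩ := ih (m + 1) (x := wdg W (c k) x) (fun q hq => hc q (by omega))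
      (wdg_mem _ hxL) (by
        intro i hi
        rw [ctr_wdg, hc k (by omega) i hi, hx i (by omega)]; simp)
    refine ⟨z, by rwa [show m + (k + 1) = m + 1 + k by ring], ?_⟩
    rw [Del_succ, h, map_smul, ctr_wdg, hx k (by omega), map_zero, sub_zero, smul_smul,
      Finset.prod_range_succ]

variable (W) in
/-- quotient of the degree `m` part by the first `q` rows -/
abbrev Yq (ψ : ℕ → Fin n → R) (q m : ℕ) : Type :=
  (Lsub R n W m) ⧸ ((Zsub W ψ q m).comap (Lsub R n W m).subtype)

lemma DP.Yq_one {I : Ideal R} {ψ : ℕ → Fin n → R} {q m : ℕ} (h : DP I 1 (Yq W ψ q m))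
    {x : Finset (Fin n) → W} (hx : x ∈ _root_.Lsub R n W m) (hu : ∀ u ∈ I, u • x ∈ Zsub W ψ q m) :
    x ∈ Zsub W ψ q m := by
  have := h.one (Submodule.Quotient.mk ⟨x, hx⟩) (by
    intro u hu'
    rw [← Submodule.Quotient.mk_smul, Submodule.Quotient.mk_eq_zero]
    exact hu u hu')
  rw [Submodule.Quotient.mk_eq_zero] at this
  exact this

lemma DP.Yq_step {I : Ideal R} {ψ : ℕ → Fin n → R} {q m k : ℕ}
    (hinj : ∀ x ∈ _root_.Lsub R n W (m + 1), ctr W (ψ q) x ∈ Zsub W ψ q m →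
      x ∈ Zsub W ψ (q + 1) (m + 1))
    (h1 : DP I (k + 1) (Yq W ψ (q + 1) (m + 1))) (h2 : DP I k (Yq W ψ q m)) :
    DP I k (Yq W ψ (q + 1) m) := by
  let f0 : _root_.Lsub R n W (m + 1) →ₗ[R] _root_.Lsub R n W m :=
    (ctr W (ψ q)).restrict (fun x hx => ctr_mem _ hx)
  let f : Yq W ψ (q + 1) (m + 1) →ₗ[R] Yq W ψ q m :=
    Submodule.mapQ _ _ f0 (fun x hx => ctr_Zsub_succ ψ q m hx)
  let g : Yq W ψ q m →ₗ[R] Yq W ψ (q + 1) m :=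
    Submodule.factor (Submodule.comap_mono le_sup_left)
  refine DP.ses f g ?_ (Submodule.factor_surjective _) ?_ h1 h2
  · rw [injective_iff_map_eq_zero]
    intro y hy
    obtain ⟨x, rfl⟩ := Submodule.Quotient.mk_surjective _ y
    have hy : (Submodule.Quotient.mk (f0 x) : Yq W ψ q m) = 0 := hy
    rw [Submodule.Quotient.mk_eq_zero] at hy
    rw [Submodule.Quotient.mk_eq_zero]
    exact hinj x x.2 hy
  · intro y
    obtain ⟨x, rfl⟩ := Submodule.Quotient.mk_surjective _ y
    constructor
    · intro hy
      have hy' : x.1 ∈ Zsub W ψ (q + 1) m := by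
        have : (Submodule.Quotient.mk x : Yq W ψ (q + 1) m) = 0 := hy
        rwa [Submodule.Quotient.mk_eq_zero] at this
      obtain ⟨z, hz, y, hy, h⟩ := mem_Zsub_succ.1 hy'
      refine ⟨Submodule.Quotient.mk ⟨y, hy⟩, ?_⟩
      show (Submodule.Quotient.mk (f0 ⟨y, hy⟩) : Yq W ψ q m) = _
      rw [Submodule.Quotient.eq]
      show ctr W (ψ q) y - x.1 ∈ Zsub W ψ q m
      rw [← h]
      simpa using hz
    · rintro ⟨w, hw⟩
      obtain ⟨y, rfl⟩ := Submodule.Quotient.mk_surjective _ w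
      rw [← hw]
      show (Submodule.Quotient.mk (f0 y) : Yq W ψ (q + 1) m) = 0
      rw [Submodule.Quotient.mk_eq_zero]
      exact mem_Zsub_succ.2 ⟨0, Submodule.zero_mem _, y, y.2, zero_add _⟩

lemma T1 {I : Ideal R} {ψ : ℕ → Fin n → R} {D m0 Q : ℕ} (hW : DP I D W) (hm0 : 1 + n ≤ D + m0)
    (H : ∀ q < Q, ∀ m, m0 ≤ m + 1 → DP I 1 (Yq W ψ (q + 1) (m + 1)) →
      ∀ x ∈ Lsub R n W (m + 1), ctr W (ψ q) x ∈ Zsub W ψ q m →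
        x ∈ Zsub W ψ (q + 1) (m + 1)) (m : ℕ) (hm : m0 ≤ m) :
    (∀ q ≤ Q, ∀ k, k + n ≤ D + m → DP I k (Yq W ψ q m)) := by
  by_cases hmn : n < m
  · intro q _ k _
    have h1 : Subsingleton (Lsub R n W m) := by rw [Lsub_eq_bot hmn]; infer_instance
    have : Subsingleton (Yq W ψ q m) := (Submodule.Quotient.mk_surjective _).subsingleton
    exact DP.of_subsingleton
  · have ih := T1 hW hm0 H (m + 1) (by omega)
    intro q hq k hk
    induction q generalizing k with
    | zero =>
      have h1 := (hW.mono (l := k) (by omega)).Lsub (n := n) m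
      refine h1.equiv (Submodule.quotEquivOfEqBot _ ?_).symm
      rw [eq_bot_iff]
      intro x hx
      exact Subtype.ext hx
    | succ q ihq =>
      exact DP.Yq_step (H q (by omega) m (by omega) (ih (q + 1) hq 1 (by omega)))
        (ih (q + 1) hq (k + 1) (by omega)) (ihq (by omega) k hk)
termination_by n + 1 - m

end Exterior


section RegSeq
open RingTheory.Sequence

lemma isSMulRegular_quot {R : Type} [CommRing R] (J : Ideal R) (x : R)
    (h : ∀ f, x * f ∈ J → f ∈ J) : IsSMulRegular (R ⧸ (J • ⊤ : Submodule R R)) x := by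
  have hJ : (J • ⊤ : Submodule R R) = J := by simp
  rw [isSMulRegular_iff_right_eq_zero_of_smul]
  intro y hy
  obtain ⟨f, rfl⟩ := Submodule.Quotient.mk_surjective _ y
  rw [← Submodule.Quotient.mk_smul, Submodule.Quotient.mk_eq_zero, hJ] at hy
  rw [Submodule.Quotient.mk_eq_zero, hJ]
  exact h f hy

lemma weaklyRegular_X {K : Type} [CommRing K] {σ : Type} (l : List σ) (hl : l.Nodup) :
    IsWeaklyRegular (MvPolynomial σ K) (l.map (X : σ → MvPolynomial σ K)) := by
  rw [isWeaklyRegular_iff_Fin]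
  rintro ⟨i, hi⟩
  refine isSMulRegular_quot _ _ fun f hf => ?_
  have hi' : i < l.length := by simpa using hi
  have h1 : Ideal.ofList (List.take i (l.map (X : σ → MvPolynomial σ K))) =
      Ideal.span (X '' {a | a ∈ l.take i}) := by
    rw [Ideal.ofList]; congr 1; ext p; simp [← List.map_take]
  have h2 : (l.map (X : σ → MvPolynomial σ K))[i] = X (l[i]) := by simp
  simp only [Fin.getElem_fin] at hf
  rw [h1, h2, mem_ideal_span_X_image] at hf
  simp only [h1]
  rw [mem_ideal_span_X_image]
  intro m hm
  obtain ⟨j, hj, hj'⟩ := hf (Finsupp.single l[i] 1 + m) (by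
    rw [mem_support_iff, coeff_X_mul]; exact mem_support_iff.1 hm)
  refine ⟨j, hj, ?_⟩
  have hne : l[i] ≠ j := by
    rintro rfl
    obtain ⟨k, hk, hk'⟩ := List.mem_iff_getElem.1 hj
    rw [List.getElem_take] at hk'
    have := (List.Nodup.getElem_inj_iff hl).1 hk'
    simp at hk
    omega
  simpa [Finsupp.single_apply, hne] using hj'

lemma weaklyRegular_C {A : Type} [CommRing A] {σ : Type} (rs : List A)
    (h : IsWeaklyRegular A rs) :
    IsWeaklyRegular (MvPolynomial σ A) (rs.map (C : A → MvPolynomial σ A)) :=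
  IsWeaklyRegular.of_flat (S := MvPolynomial σ A) h

lemma weaklyRegular_CX {A : Type} [CommRing A] {σ : Type} (rs : List A)
    (h : IsWeaklyRegular A rs) (s : σ) :
    IsWeaklyRegular (MvPolynomial σ A) (rs.map (C : A → MvPolynomial σ A) ++ [X s]) := by
  rw [isWeaklyRegular_append_iff]
  refine ⟨weaklyRegular_C rs h, ?_⟩
  rw [isWeaklyRegular_singleton_iff]
  refine isSMulRegular_quot _ _ fun f hf => ?_
  have h1 : Ideal.ofList (rs.map (C : A → MvPolynomial σ A)) = (Ideal.ofList rs).map C :=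
    (Ideal.map_ofList (C : A →+* MvPolynomial σ A) rs).symm
  rw [h1, mem_map_C_iff] at hf
  rw [h1, mem_map_C_iff]
  intro m
  have := hf (Finsupp.single s 1 + m)
  rwa [coeff_X_mul] at this

/-- triangular automorphism -/
lemma exists_auto {K : Type} [CommRing K] {σ : Type} [DecidableEq σ] (s : Set σ)
    (u : K) (hu : IsUnit u) (l : σ → MvPolynomial σ K)
    (hl : ∀ p, ∀ g : σ → MvPolynomial σ K, (∀ q ∈ s, g q = X q) → aeval g (l p) = l p) :
    ∃ e : MvPolynomial σ K ≃ₐ[K] MvPolynomial σ K, ∀ p ∉ s, e (X p) = C u * X p - l p := by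
  classical
  obtain ⟨v, hv⟩ := hu.exists_right_inv
  let f : σ → MvPolynomial σ K := fun p => if p ∈ s then X p else C u * X p - l p
  let g : σ → MvPolynomial σ K := fun p => if p ∈ s then X p else C v * (X p + l p)
  have hf : ∀ q ∈ s, f q = X q := fun q hq => by simp [f, hq]
  have hg : ∀ q ∈ s, g q = X q := fun q hq => by simp [g, hq]
  have hC : (C u * C v : MvPolynomial σ K) = 1 := by rw [← C_mul, hv, C_1]
  have hA : ∀ (w : K) (h : σ → MvPolynomial σ K), aeval h (C w : MvPolynomial σ K) = C w := by
    intro w h; rw [aeval_C]; rfl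
  refine ⟨AlgEquiv.ofAlgHom (aeval f) (aeval g) ?_ ?_, ?_⟩
  · ext1 p
    by_cases hp : p ∈ s
    · simp [hf p hp, hg p hp]
    · have h1 : f p = C u * X p - l p := by simp [f, hp]
      have h2 : g p = C v * (X p + l p) := by simp [g, hp]
      simp only [AlgHom.comp_apply, aeval_X, h2, map_mul, map_add, hl p f hf, h1, hA,
        AlgHom.id_apply]
      linear_combination (X p) * hC
  · ext1 p
    by_cases hp : p ∈ s
    · simp [hf p hp, hg p hp]
    · have h1 : f p = C u * X p - l p := by simp [f, hp]
      have h2 : g p = C v * (X p + l p) := by simp [g, hp]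
      simp only [AlgHom.comp_apply, aeval_X, h2, map_mul, map_sub, hl p g hg, h1, hA,
        AlgHom.id_apply]
      linear_combination (X p + l p) * hC
  · intro p hp
    simp [f, hp]

end RegSeq

section Columns
variable {A : Type} [CommRing A] {n r : ℕ}

/-- the rows -/
noncomputable def rowF (φ : Fin r → Fin n → A) (i : ℕ) (q : Fin n) : MvPolynomial (Fin n) A :=
  if h : i < r then C (φ ⟨i, h⟩ q) else X q

/-- the chosen minor as a matrix -/
def mJ (φ : Fin r → Fin n → A) (J : Fin r → Fin n) : Matrix (Fin r) (Fin r) A :=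
  Matrix.of fun i k => φ i (J k)

/-- columns with `φ c_i = b e_i` -/
noncomputable def cJ (φ : Fin r → Fin n → A) (J : Fin r → Fin n) (i : Fin r) (q : Fin n) : A :=
  ∑ k, if q = J k then (mJ φ J).adjugate k i else 0

/-- entries of `adj * φ` -/
noncomputable def aJ (φ : Fin r → Fin n → A) (J : Fin r → Fin n) (p : Fin n) (k : Fin r) : A :=
  ∑ i, (mJ φ J).adjugate k i * φ i p

/-- kernel vectors -/
noncomputable def vJ (φ : Fin r → Fin n → A) (J : Fin r → Fin n) (p : Fin n) (q : Fin n) : A :=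
  (if q = p then (mJ φ J).det else 0) -
    ∑ k, if q = J k then aJ φ J p k else 0

lemma phi_cJ (φ : Fin r → Fin n → A) (J : Fin r → Fin n) (i j : Fin r) :
    ∑ q, φ j q * cJ φ J i q = if j = i then (mJ φ J).det else 0 := by
  have h1 : ∑ q, φ j q * cJ φ J i q = (mJ φ J * (mJ φ J).adjugate) j i := by
    simp only [cJ, Finset.mul_sum]
    rw [Finset.sum_comm, Matrix.mul_apply]
    simp [mJ]
  rw [h1, Matrix.mul_adjugate]
  simp [Matrix.one_apply]

lemma phi_vJ (φ : Fin r → Fin n → A) (J : Fin r → Fin n) (p : Fin n) (j : Fin r) :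
    ∑ q, φ j q * vJ φ J p q = 0 := by
  have h2 : ∑ k, φ j (J k) * aJ φ J p k = φ j p * (mJ φ J).det := by
    have : ∑ k, φ j (J k) * aJ φ J p k =
        ∑ i, (mJ φ J * (mJ φ J).adjugate) j i * φ i p := by
      simp only [Matrix.mul_apply, aJ, Finset.mul_sum, Finset.sum_mul]
      rw [Finset.sum_comm]
      simp [mJ, mul_assoc]
    rw [this, Matrix.mul_adjugate]
    simp [Matrix.one_apply, mul_comm]
  simp only [vJ, mul_sub, Finset.sum_sub_distrib]
  have h3 : ∑ q, φ j q * ∑ k, (if q = J k then aJ φ J p k else 0) =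
      ∑ k, φ j (J k) * aJ φ J p k := by
    simp only [Finset.mul_sum]
    rw [Finset.sum_comm]
    simp
  rw [h3, h2]
  simp

/-- `T(v_p)` -/
noncomputable def lamJ (φ : Fin r → Fin n → A) (J : Fin r → Fin n) (p : Fin n) :
    MvPolynomial (Fin n) A := ∑ q, X q * C (vJ φ J p q)

/-- the ideal used in the localised step -/
noncomputable def idJ (φ : Fin r → Fin n → A) (J : Fin r → Fin n) :
    Ideal (MvPolynomial (Fin n) A) :=
  Ideal.span (Set.range fun p => C (mJ φ J).det ^ r * lamJ φ J p)

lemma lamJ_eq (φ : Fin r → Fin n → A) (J : Fin r → Fin n) (p : Fin n) :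
    lamJ φ J p = C (mJ φ J).det * X p -
      ∑ k, C (aJ φ J p k) * X (J k) := by
  simp only [lamJ, vJ, C_sub, mul_sub, Finset.sum_sub_distrib]
  congr 1
  · rw [Finset.sum_eq_single p]
    · simp [mul_comm]
    · intro q _ hq; simp [hq]
    · simp
  · simp only [map_sum, Finset.mul_sum]
    rw [Finset.sum_comm]
    refine Finset.sum_congr rfl fun k _ => ?_
    rw [Finset.sum_eq_single (J k)]
    · rw [if_pos rfl, mul_comm]
    · intro q _ hq; simp [hq]
    · simp

end Columns


section LocW
open RingTheory.Sequence
variable {A : Type} [CommRing A] {n r : ℕ}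

lemma exists_W (φ : Fin r → Fin n → A) (J : Fin r → Fin n) (hJ : Function.Injective J) :
    ∃ (W : Type) (_ : AddCommGroup W) (_ : Module (MvPolynomial (Fin n) A) W)
      (ι : MvPolynomial (Fin n) A →ₗ[MvPolynomial (Fin n) A] W),
      DP (idJ φ J) (n - r) W ∧
      (∀ x, ι x = 0 → ∃ N : ℕ, (C (mJ φ J).det : MvPolynomial (Fin n) A) ^ N • x = 0) ∧
      (∀ w, ∃ N : ℕ, ∃ x, (C (mJ φ J).det : MvPolynomial (Fin n) A) ^ N • w = ι x) := by
  classical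
  set b := (mJ φ J).det with hb
  let Ab := Localization.Away b
  let alg : Algebra (MvPolynomial (Fin n) A) (MvPolynomial (Fin n) Ab) :=
    MvPolynomial.algebraMvPolynomial
  have hloc : IsLocalization ((Submonoid.powers b).map (C (σ := Fin n)))
    (MvPolynomial (Fin n) Ab) := MvPolynomial.isLocalization _ _
  have halg : ∀ x : MvPolynomial (Fin n) A, algebraMap (MvPolynomial (Fin n) A)
    (MvPolynomial (Fin n) Ab) x = MvPolynomial.map (algebraMap A Ab) x := fun x => rfl
  refine ⟨MvPolynomial (Fin n) Ab, inferInstance, inferInstance,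
    Algebra.linearMap _ _, ?_, ?_, ?_⟩
  · -- regular sequence
    have hbu : IsUnit (algebraMap A Ab b) := IsLocalization.Away.algebraMap_isUnit b
    let l : Fin n → MvPolynomial (Fin n) Ab := fun p =>
      C (algebraMap A Ab b ^ r) * ∑ k, C (algebraMap A Ab (aJ φ J p k)) * X (J k)
    obtain ⟨e, he⟩ := exists_auto (K := Ab) (Set.range J) (algebraMap A Ab b ^ (r + 1))
      (hbu.pow _) l (by
        intro p g hg
        simp only [l, map_mul, map_sum, aeval_X, aeval_C, hg _ (Set.mem_range_self _)]
        rfl)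
    let L : List (Fin n) := (Finset.univ \ Finset.univ.image J).toList
    have hLlen : L.length = n - r := by
      simp only [L, Finset.length_toList]
      rw [Finset.card_sdiff_of_subset (Finset.subset_univ _),
        Finset.card_image_of_injective _ hJ]
      simp
    have hLreg := weaklyRegular_X (K := Ab) L (Finset.nodup_toList _)
    have hreg : IsWeaklyRegular (R := MvPolynomial (Fin n) A) (MvPolynomial (Fin n) Ab)
        (L.map fun p => C b ^ r * lamJ φ J p) := by
      refine (AddEquiv.isWeaklyRegular_congr (e := e.toRingEquiv.toAddEquiv) ?_).1 hLreg
      rw [List.forall₂_map_left_iff, List.forall₂_map_right_iff, List.forall₂_same]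
      intro p hp x
      have hp' : p ∉ Set.range J := by
        simpa [L] using hp
      show e (X p * x) = _ • e x
      rw [map_mul, he p hp', Algebra.smul_def, halg, lamJ_eq, ← hb]
      congr 1
      simp only [l, map_mul, map_sub, map_sum, map_pow, MvPolynomial.map_C, MvPolynomial.map_X]
      ring
    rw [← hLlen, ← List.length_map (f := fun p => C b ^ r * lamJ φ J p)]
    refine DP.of_regular _ _ ?_ hreg
    intro u hu
    obtain ⟨p, -, rfl⟩ := List.mem_map.1 hu
    exact Ideal.subset_span ⟨p, rfl⟩
  · intro x hx
    have hx' : algebraMap (MvPolynomial (Fin n) A) (MvPolynomial (Fin n) Ab) x =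
      algebraMap (MvPolynomial (Fin n) A) (MvPolynomial (Fin n) Ab) 0 := by rw [map_zero]; exact hx
    obtain ⟨⟨_, ⟨_, ⟨N, rfl⟩, rfl⟩⟩, h⟩ := IsLocalization.exists_of_eq
      (M := (Submonoid.powers b).map (C (σ := Fin n))) hx'
    refine ⟨N, ?_⟩
    simpa using h
  · intro w
    obtain ⟨⟨x, ⟨_, ⟨_, ⟨N, rfl⟩, rfl⟩⟩⟩, h⟩ := IsLocalization.surj
      ((Submonoid.powers b).map (C (σ := Fin n))) w
    refine ⟨N, x, ?_⟩
    rw [Algebra.smul_def, mul_comm, Algebra.linearMap_apply, ← h]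
    simp

end LocW

section Transfer
variable {R : Type} [CommRing R] {n : ℕ} {W W' : Type} [AddCommGroup W] [Module R W]
  [AddCommGroup W'] [Module R W'] (ι : W →ₗ[R] W')

/-- functoriality of the exterior model -/
def eMap : (Finset (Fin n) → W) →ₗ[R] (Finset (Fin n) → W') := LinearMap.compLeft ι _

lemma eMap_apply (x : Finset (Fin n) → W) (S) : eMap ι x S = ι (x S) := rfl

lemma eMap_ctr (φ : Fin n → R) (x : Finset (Fin n) → W) :
    eMap ι (ctr W φ x) = ctr W' φ (eMap ι x) := by
  ext S
  rw [eMap_apply, ctr_apply, ctr_apply, Finset.sum_apply, Finset.sum_apply, map_sum]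
  refine Finset.sum_congr rfl fun j _ => ?_
  simp only [Pi.smul_apply, fann_apply, map_smul]
  split_ifs
  · simp
  · rw [map_zsmul]; rfl

lemma eMap_Lsub {m : ℕ} {x : Finset (Fin n) → W} (hx : x ∈ Lsub R n W m) :
    eMap ι x ∈ Lsub R n W' m := fun S hS => by rw [eMap_apply, hx S hS, map_zero]

lemma eMap_Zsub (ψ : ℕ → Fin n → R) {q m : ℕ} {x : Finset (Fin n) → W} (hx : x ∈ Zsub W ψ q m) :
    eMap ι x ∈ Zsub W' ψ q m := by
  induction q generalizing x with
  | zero =>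
    have : x = 0 := hx
    simp [this]
  | succ q ih =>
    obtain ⟨z, hz, y, hy, rfl⟩ := mem_Zsub_succ.1 hx
    exact mem_Zsub_succ.2 ⟨_, ih hz, _, eMap_Lsub ι hy, by rw [map_add, eMap_ctr]⟩

lemma eMap_Del (ψ : ℕ → Fin n → R) (k : ℕ) (x : Finset (Fin n) → W) :
    eMap ι (Del W ψ k x) = Del W' ψ k (eMap ι x) := by
  induction k with
  | zero => rfl
  | succ k ih => rw [Del_succ, Del_succ, eMap_ctr, ih]

variable {ι} {b : R}

lemma eMap_ker
    (hker : ∀ x, ι x = 0 → ∃ N : ℕ, b ^ N • x = 0)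
    (x : Finset (Fin n) → W) (hx : eMap ι x = 0) : ∃ N : ℕ, b ^ N • x = 0 := by
  choose N hN using fun S => hker (x S) (congrFun hx S)
  refine ⟨∑ S, N S, ?_⟩
  ext S
  rw [Pi.smul_apply, ← Finset.add_sum_erase _ _ (Finset.mem_univ S), add_comm, pow_add, mul_smul,
    hN, smul_zero, Pi.zero_apply]

lemma eMap_surj
    (hsurj : ∀ w, ∃ N : ℕ, ∃ x, b ^ N • w = ι x)
    {m : ℕ} {w : Finset (Fin n) → W'} (hw : w ∈ Lsub R n W' m) :
    ∃ N : ℕ, ∃ x ∈ Lsub R n W m, b ^ N • w = eMap ι x := by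
  choose N x hN using fun S => hsurj (w S)
  refine ⟨∑ S, N S, fun S => if S.card = m then
    b ^ (∑ T ∈ Finset.univ.erase S, N T) • x S else 0, ?_, ?_⟩
  · intro S hS; simp [hS]
  · ext S
    rw [eMap_apply]
    split_ifs with h
    · rw [map_smul, ← hN, smul_smul, ← pow_add, Pi.smul_apply,
        Finset.sum_erase_add _ _ (Finset.mem_univ S)]
    · rw [Pi.smul_apply, hw S h]; simp

lemma eMap_surj_Z
    (hsurj : ∀ w, ∃ N : ℕ, ∃ x, b ^ N • w = ι x)
    (ψ : ℕ → Fin n → R) {q m : ℕ} {w : Finset (Fin n) → W'}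
    (hw : w ∈ Zsub W' ψ q m) :
    ∃ N : ℕ, ∃ x ∈ Zsub W ψ q m, b ^ N • w = eMap ι x := by
  induction q generalizing w with
  | zero =>
    have : w = 0 := hw
    exact ⟨0, 0, Submodule.zero_mem _, by simp [this]⟩
  | succ q ih =>
    obtain ⟨z, hz, y, hy, rfl⟩ := mem_Zsub_succ.1 hw
    obtain ⟨N, z', hz', h1⟩ := ih hz
    obtain ⟨N', y', hy', h2⟩ := eMap_surj hsurj hy
    refine ⟨N + N', _, mem_Zsub_succ.2 ⟨b ^ N' • z', Submodule.smul_mem _ _ hz', b ^ N • y',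
      Submodule.smul_mem _ _ hy', rfl⟩, ?_⟩
    rw [map_add, map_smul, ← h1, map_smul, map_smul, eMap_ctr, ← h2, map_smul, smul_add,
      smul_smul, smul_smul, ← pow_add, ← pow_add, add_comm N']

lemma torsion_of_Z
    (hker : ∀ x, ι x = 0 → ∃ N : ℕ, b ^ N • x = 0)
    (hsurj : ∀ w, ∃ N : ℕ, ∃ x, b ^ N • w = ι x)
    (ψ : ℕ → Fin n → R) {q m : ℕ} {x : Finset (Fin n) → W}
    (hx : eMap ι x ∈ Zsub W' ψ q m) : ∃ N : ℕ, b ^ N • x ∈ Zsub W ψ q m := by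
  obtain ⟨N, z, hz, h⟩ := eMap_surj_Z hsurj ψ hx
  obtain ⟨N', h'⟩ := eMap_ker hker (b ^ N • x - z) (by rw [map_sub, map_smul, h, sub_self])
  refine ⟨N' + N, ?_⟩
  rw [smul_sub, sub_eq_zero, smul_smul, ← pow_add] at h'
  rw [h']
  exact Submodule.smul_mem _ _ hz

lemma torsion_of_Del
    (hker : ∀ x, ι x = 0 → ∃ N : ℕ, b ^ N • x = 0)
    (hsurj : ∀ w, ∃ N : ℕ, ∃ x, b ^ N • w = ι x)
    (ψ : ℕ → Fin n → R) {k m : ℕ} {x : Finset (Fin n) → W}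
    {w : Finset (Fin n) → W'} (hw : w ∈ Lsub R n W' m) (hx : eMap ι x = Del W' ψ k w) :
    ∃ N : ℕ, ∃ z ∈ Lsub R n W m, b ^ N • x = Del W ψ k z := by
  obtain ⟨N, z, hz, h⟩ := eMap_surj hsurj hw
  obtain ⟨N', h'⟩ := eMap_ker hker (b ^ N • x - Del W ψ k z)
    (by rw [map_sub, map_smul, hx, eMap_Del, ← h, map_smul, sub_self])
  refine ⟨N' + N, b ^ N' • z, Submodule.smul_mem _ _ hz, ?_⟩
  rw [smul_sub, sub_eq_zero, smul_smul, ← pow_add] at h'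
  rw [h', map_smul]

end Transfer


section Tors

lemma TL {A B Y : Type} [CommRing A] [IsLocalRing A] [IsNoetherianRing A] [CommRing B]
    (f : A →+* B) [AddCommGroup Y] [Module B Y] (κ : Y)
    (hκ : ∀ p : Ideal A, p.IsPrime → p ≠ maximalIdeal A → ∃ b ∉ p, ∃ N : ℕ, f b ^ N • κ = 0)
    (h : ∀ a : A, (∀ u ∈ maximalIdeal A, f u • f a • κ = 0) → f a • κ = 0) : κ = 0 := by
  by_contra hne
  let _ : Module A Y := Module.compHom Y f
  have hs : ∀ (a : A) (y : Y), a • y = f a • y := fun _ _ => rfl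
  let N : Submodule A Y := Submodule.span A {κ}
  have hN : Nontrivial N := ⟨⟨κ, Submodule.mem_span_singleton_self κ⟩, 0, fun h0 =>
    hne (congrArg Subtype.val h0)⟩
  obtain ⟨p, hp⟩ := associatedPrimes.nonempty A N
  obtain ⟨hpp, ⟨x, hx⟩, hpx⟩ := isAssociatedPrime_iff.1 hp
  obtain ⟨a, rfl⟩ := Submodule.mem_span_singleton.1 hx
  have hmem : ∀ u : A, u ∈ p ↔ f u • f a • κ = 0 := by
    intro u
    rw [hpx, Submodule.mem_colon_singleton, Submodule.mem_bot, Subtype.ext_iff]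
    rfl
  by_cases hpm : p = maximalIdeal A
  · have := h a (fun u hu => (hmem u).1 (hpm ▸ hu))
    apply hpp.ne_top
    rw [Ideal.eq_top_iff_one, hmem, this, smul_zero]
  · obtain ⟨b, hb, N, hbN⟩ := hκ p hpp hpm
    apply hb
    apply hpp.mem_of_pow_mem N
    rw [hmem, map_pow, smul_comm, hbN, smul_zero]

end Tors

section Splice
variable {R : Type} [CommRing R] {n : ℕ} {W : Type} [AddCommGroup W] [Module R W]

variable (W) in
/-- image of the splice map in degree one -/
def imD (ψ : ℕ → Fin n → R) (ρ : ℕ) : Submodule R (Finset (Fin n) → W) :=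
  (Lsub R n W (1 + ρ)).map (Del W ψ ρ)

lemma DP.coker {I : Ideal R} {ψ : ℕ → Fin n → R} {ρ k : ℕ}
    (ha : ∀ x ∈ _root_.Lsub R n W (1 + ρ), Del W ψ ρ x = 0 → x ∈ Zsub W ψ ρ (1 + ρ))
    (h1 : DP I (k + 1) (Yq W ψ ρ (1 + ρ))) (h2 : DP I k W) :
    DP I k (_root_.Lsub R n W 1 ⧸ (imD W ψ ρ).comap (_root_.Lsub R n W 1).subtype) := by
  let f0 : _root_.Lsub R n W (1 + ρ) →ₗ[R] _root_.Lsub R n W 1 :=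
    (Del W ψ ρ).restrict (fun x hx => Del_mem ψ ρ 1 hx)
  let f : Yq W ψ ρ (1 + ρ) →ₗ[R] _root_.Lsub R n W 1 := Submodule.liftQ _ f0 (by
    intro x hx
    exact Subtype.ext (Del_Zsub ψ ρ _ hx))
  refine DP.ses f (Submodule.mkQ _) ?_ (Submodule.mkQ_surjective _) ?_ h1 (h2.Lsub 1)
  · rw [injective_iff_map_eq_zero]
    intro y hy
    obtain ⟨x, rfl⟩ := Submodule.Quotient.mk_surjective _ y
    rw [Submodule.Quotient.mk_eq_zero]
    exact ha x x.2 (congrArg Subtype.val hy)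
  · intro y
    rw [Submodule.mkQ_apply, Submodule.Quotient.mk_eq_zero]
    constructor
    · rintro ⟨x, hx, hxy⟩
      exact ⟨Submodule.Quotient.mk ⟨x, hx⟩, Subtype.ext hxy⟩
    · rintro ⟨w, rfl⟩
      obtain ⟨x, rfl⟩ := Submodule.Quotient.mk_surjective _ w
      exact ⟨x, x.2, rfl⟩

/-- the map from degree one to `W^ρ` -/
def gmap (ψ : ℕ → Fin n → R) (ρ : ℕ) : Lsub R n W 1 →ₗ[R] (Fin ρ → W) where
  toFun x i := ctr W (ψ i) x ∅
  map_add' x y := by ext i; simp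
  map_smul' c x := by ext i; simp

lemma gmap_apply (ψ : ℕ → Fin n → R) (ρ : ℕ) (x : Lsub R n W 1) (i : Fin ρ) :
    gmap ψ ρ x i = ∑ q, ψ i q • x.1 {q} := by
  show ctr W (ψ i) x ∅ = _
  rw [ctr_apply, Finset.sum_apply]
  refine Finset.sum_congr rfl fun q _ => ?_
  simp [fann_apply, fsgn]

lemma mem_range_gmap (ψ : ℕ → Fin n → R) (ρ : ℕ) (y : Fin ρ → W) :
    y ∈ LinearMap.range (gmap (W := W) ψ ρ) ↔ ∃ c : Fin n → W, ∀ i, y i = ∑ q, ψ i q • c q := by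
  classical
  constructor
  · rintro ⟨x, rfl⟩
    exact ⟨fun q => x.1 {q}, fun i => gmap_apply ψ ρ x i⟩
  · rintro ⟨c, hc⟩
    refine ⟨⟨fun S => ∑ q, if S = {q} then c q else 0, ?_⟩, ?_⟩
    · intro S hS
      refine Finset.sum_eq_zero fun q _ => ?_
      rw [if_neg]
      rintro rfl
      simp at hS
    · ext i
      rw [gmap_apply, hc]
      simp

lemma DP.coker2 {I : Ideal R} {ψ : ℕ → Fin n → R} {ρ k : ℕ}
    (ha : ∀ x ∈ _root_.Lsub R n W (1 + ρ), Del W ψ ρ x = 0 → x ∈ Zsub W ψ ρ (1 + ρ))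
    (hb : ∀ x ∈ _root_.Lsub R n W 1, (∀ i < ρ, ctr W (ψ i) x = 0) → x ∈ imD W ψ ρ)
    (h1 : DP I (k + 2) (Yq W ψ ρ (1 + ρ))) (h2 : DP I (k + 1) W) :
    DP I k ((Fin ρ → W) ⧸ LinearMap.range (gmap (W := W) ψ ρ)) := by
  have h3 := DP.coker ha h1 h2
  have key : ∀ x : _root_.Lsub R n W 1, gmap ψ ρ x = 0 ↔ x.1 ∈ imD W ψ ρ := by
    intro x
    constructor
    · intro hx
      refine hb x x.2 fun i hi => ?_
      ext S
      by_cases hS : S.card = 0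
      · rw [Finset.card_eq_zero] at hS
        subst hS
        exact congrFun hx ⟨i, hi⟩
      · exact ctr_mem (m := 0) (ψ i) x.2 S hS
    · rintro ⟨z, hz, hzx⟩
      ext i
      show ctr W (ψ i) x ∅ = 0
      rw [← hzx]
      have : ∀ k : ℕ, (i : ℕ) < k → ctr W (ψ i) (Del W ψ k z) = 0 := by
        intro k hk
        induction k with
        | zero => omega
        | succ k ih =>
          rw [Del_succ]
          rcases Nat.lt_succ_iff_lt_or_eq.1 hk with h | h
          · rw [ctr_ctr, ih h]; simp
          · rw [h, ctr_self]
      rw [this ρ i.2]; rfl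
  refine DP.ses (Submodule.liftQ _ (gmap ψ ρ) ?_) (Submodule.mkQ _) ?_
    (Submodule.mkQ_surjective _) ?_ h3 ((h2.mono (Nat.le_succ k)).pi _)
  · intro x hx
    exact (key x).2 hx
  · rw [injective_iff_map_eq_zero]
    intro y hy
    obtain ⟨x, rfl⟩ := Submodule.Quotient.mk_surjective _ y
    rw [Submodule.Quotient.mk_eq_zero]
    exact (key x).1 hy
  · intro y
    rw [Submodule.mkQ_apply, Submodule.Quotient.mk_eq_zero]
    constructor
    · rintro ⟨x, rfl⟩
      exact ⟨Submodule.Quotient.mk x, rfl⟩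
    · rintro ⟨w, rfl⟩
      obtain ⟨x, rfl⟩ := Submodule.Quotient.mk_surjective _ w
      exact ⟨x, rfl⟩

end Splice

section WStep
variable {A : Type} [CommRing A] {n r : ℕ}

lemma rowF_cJ (φ : Fin r → Fin n → A) (J : Fin r → Fin n) (i : ℕ) (hi : i < r) (j : Fin r) :
    ∑ q, rowF φ i q * C (cJ φ J j q) = if i = j then C (mJ φ J).det else 0 := by
  have h := phi_cJ φ J j ⟨i, hi⟩
  simp only [rowF, hi, dif_pos, ← C_mul, ← map_sum, h, Fin.ext_iff]
  split_ifs <;> simp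

lemma rowF_vJ (φ : Fin r → Fin n → A) (J : Fin r → Fin n) (i : ℕ) (hi : i < r) (p : Fin n) :
    ∑ q, rowF φ i q * C (vJ φ J p q) = 0 := by
  have h := phi_vJ φ J p ⟨i, hi⟩
  simp only [rowF, hi, dif_pos, ← C_mul, ← map_sum, h, map_zero]

lemma rowF_vJ_last (φ : Fin r → Fin n → A) (J : Fin r → Fin n) (p : Fin n) :
    ∑ q, rowF φ r q * C (vJ φ J p q) = lamJ φ J p := by
  simp [rowF, lamJ]

/-- triangular system of columns -/
noncomputable def colJ (φ : Fin r → Fin n → A) (J : Fin r → Fin n) (p : Fin n) (i : ℕ) (q : Fin n) :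
    MvPolynomial (Fin n) A :=
  if h : i < r then C (cJ φ J ⟨i, h⟩ q) else C (vJ φ J p q)

lemma colJ_tri (φ : Fin r → Fin n → A) (J : Fin r → Fin n) (p : Fin n) :
    ∀ q < r + 1, ∀ i < q, ∑ j, rowF φ i j * colJ φ J p q j = 0 := by
  intro q hq i hi
  by_cases h : q < r
  · simp only [colJ, h, dif_pos]
    rw [rowF_cJ φ J i (by omega)]
    simp only [ite_eq_right_iff]
    omega
  · simp only [colJ, h, dif_neg, not_false_eq_true]
    exact rowF_vJ φ J i (by omega) p

lemma colJ_diag (φ : Fin r → Fin n → A) (J : Fin r → Fin n) (p : Fin n) (q : ℕ) (hq : q < r) :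
    ∑ j, rowF φ q j * colJ φ J p q j = C (mJ φ J).det := by
  simp only [colJ, hq, dif_pos]
  rw [rowF_cJ φ J q hq, if_pos rfl]

lemma colJ_diag_last (φ : Fin r → Fin n → A) (J : Fin r → Fin n) (p : Fin n) :
    ∑ j, rowF φ r j * colJ φ J p r j = lamJ φ J p := by
  simp only [colJ, lt_irrefl, dif_neg, not_false_eq_true]
  exact rowF_vJ_last φ J p

lemma colJ_prod (φ : Fin r → Fin n → A) (J : Fin r → Fin n) (p : Fin n) :
    ∏ q ∈ Finset.range (r + 1), ∑ j, rowF φ q j * colJ φ J p q j =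
      C (mJ φ J).det ^ r * lamJ φ J p := by
  rw [Finset.prod_range_succ, colJ_diag_last]
  congr 1
  rw [Finset.prod_congr rfl (fun q hq => colJ_diag φ J p q (Finset.mem_range.1 hq))]
  simp

lemma idJ_kill {φ : Fin r → Fin n → A} {J : Fin r → Fin n} {Y : Type} [AddCommGroup Y]
    [Module (MvPolynomial (Fin n) A) Y] (Z : Submodule (MvPolynomial (Fin n) A) Y) (y : Y)
    (h : ∀ p, (C (mJ φ J).det ^ r * lamJ φ J p) • y ∈ Z) : ∀ u ∈ idJ φ J, u • y ∈ Z := by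
  intro u hu
  have : idJ φ J ≤ Z.comap (LinearMap.toSpanSingleton _ Y y) := by
    refine Ideal.span_le.2 ?_
    rintro _ ⟨p, rfl⟩
    exact h p
  exact this hu

variable {W : Type} [AddCommGroup W] [Module (MvPolynomial (Fin n) A) W]

lemma W_H (φ : Fin r → Fin n → A) (J : Fin r → Fin n) (hr : 0 < r)
    (q : ℕ) (hq : q < r + 1) (m : ℕ) (h : DP (idJ φ J) 1 (Yq W (rowF φ) (q + 1) (m + 1)))
    (x) (hx : x ∈ Lsub (MvPolynomial (Fin n) A) n W (m + 1))
    (hz : ctr W (rowF φ q) x ∈ Zsub W (rowF φ) q m) : x ∈ Zsub W (rowF φ) (q + 1) (m + 1) := by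
  refine h.Yq_one hx (idJ_kill _ _ fun p => ?_)
  have h1 := one_step (rowF φ) (colJ φ J p q) q m (colJ_tri φ J p q hq) hx hz
  by_cases hqr : q < r
  · rw [colJ_diag φ J p q hqr] at h1
    obtain ⟨s, rfl⟩ : ∃ s, r = s + 1 := ⟨r - 1, by omega⟩
    rw [pow_succ, mul_assoc, mul_comm (C _), mul_comm, mul_assoc, mul_comm, mul_smul]
    have := Submodule.smul_mem _ (lamJ φ J p * C (mJ φ J).det ^ s) h1
    convert this using 1
    rw [smul_smul, smul_smul]
    congr 1
    ring
  · obtain rfl : q = r := by omega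
    rw [colJ_diag_last] at h1
    rw [mul_smul]
    exact Submodule.smul_mem _ _ h1

lemma W_all (φ : Fin r → Fin n → A) (J : Fin r → Fin n) (hr : 0 < r) (hrn : r ≤ n)
    (hW : DP (idJ φ J) (n - r) W) :
    (∀ m, r + 1 ≤ m → ∀ q ≤ r + 1, ∀ k, k + r ≤ m → DP (idJ φ J) k (Yq W (rowF φ) q m)) ∧
    (∀ q < r + 1, ∀ m, r + 1 ≤ m + 1 → ∀ x ∈ Lsub (MvPolynomial (Fin n) A) n W (m + 1),
      ctr W (rowF φ q) x ∈ Zsub W (rowF φ) q m → x ∈ Zsub W (rowF φ) (q + 1) (m + 1)) ∧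
    (∀ x ∈ Lsub (MvPolynomial (Fin n) A) n W (1 + (r + 1)), Del W (rowF φ) (r + 1) x = 0 →
      x ∈ Zsub W (rowF φ) (r + 1) (1 + (r + 1))) ∧
    (r + 1 ≤ n → ∀ x ∈ Lsub (MvPolynomial (Fin n) A) n W 1,
      (∀ i < r + 1, ctr W (rowF φ i) x = 0) →
      x ∈ imD W (rowF φ) (r + 1)) := by
  have h1 : ∀ m, r + 1 ≤ m → ∀ q ≤ r + 1, ∀ k, k + r ≤ m →
      DP (idJ φ J) k (Yq W (rowF φ) q m) := by
    intro m hm q hq k hk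
    refine T1 (Q := r + 1) hW (m0 := r + 1) (by omega) ?_ m hm q hq k (by omega)
    intro q hq m _ h x hx hz
    exact W_H φ J hr q hq m h x hx hz
  have h3 : ∀ x ∈ Lsub (MvPolynomial (Fin n) A) n W (1 + (r + 1)), Del W (rowF φ) (r + 1) x = 0 →
      x ∈ Zsub W (rowF φ) (r + 1) (1 + (r + 1)) := by
    intro x hx h
    refine (h1 (1 + (r + 1)) (by omega) (r + 1) le_rfl 1 (by omega)).Yq_one hx
      (idJ_kill _ _ fun p => ?_)
    rw [← colJ_prod]
    exact splice_a (rowF φ) (colJ φ J p) (r + 1) 1 (colJ_tri φ J p) hx h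
  refine ⟨h1, ?_, h3, ?_⟩
  · intro q hq m hm x hx hz
    exact W_H φ J hr q hq m (h1 (m + 1) hm (q + 1) (by omega) 1 (by omega)) x hx hz
  · intro hn x hx h
    have h4 := DP.coker (k := 1) h3 (h1 (1 + (r + 1)) (by omega) (r + 1) le_rfl 2 (by omega))
      (hW.mono (by omega))
    have h5 := h4.one (Submodule.Quotient.mk ⟨x, hx⟩) (by
      intro u hu
      rw [← Submodule.Quotient.mk_smul, Submodule.Quotient.mk_eq_zero]
      refine idJ_kill (imD W (rowF φ) (r + 1)) x (fun p => ?_) u hu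
      rw [← colJ_prod]
      obtain ⟨z, hz, hzx⟩ := splice_b (rowF φ) (colJ φ J p) (r + 1) 1 (colJ_tri φ J p) hx h
      exact ⟨z, hz, hzx⟩)
    rw [Submodule.Quotient.mk_eq_zero] at h5
    exact h5

end WStep

section BStep
variable {A : Type} [CommRing A] [IsLocalRing A] [IsNoetherianRing A] {n r : ℕ}

lemma TL_sub {Y : Type} [AddCommGroup Y] [Module (MvPolynomial (Fin n) A) Y]
    {φ : Fin r → Fin n → A}
    (hcol : ∀ p : Ideal A, p.IsPrime → p ≠ maximalIdeal A →
      ∃ J : Fin r → Fin n, Function.Injective J ∧ (mJ φ J).det ∉ p)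
    (h : DP ((maximalIdeal A).map (C (σ := Fin n))) 1 Y) (y : Y)
    (hy : ∀ J : Fin r → Fin n, Function.Injective J → ∃ N : ℕ,
      (C (mJ φ J).det : MvPolynomial (Fin n) A) ^ N • y = 0) : y = 0 := by
  refine TL (C (σ := Fin n) (R := A)) y ?_ ?_
  · intro p hp hpm
    obtain ⟨J, hJ, hJp⟩ := hcol p hp hpm
    obtain ⟨N, hN⟩ := hy J hJ
    exact ⟨_, hJp, N, hN⟩
  · intro a ha
    refine h.one _ fun u hu => ?_
    have : (maximalIdeal A).map (C (σ := Fin n)) ≤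
        LinearMap.ker (LinearMap.toSpanSingleton (MvPolynomial (Fin n) A) Y
          ((C a : MvPolynomial (Fin n) A) • y)) := by
      refine Ideal.span_le.2 ?_
      rintro _ ⟨v, hv, rfl⟩
      exact ha v hv
    exact this hu

lemma B_all (φ : Fin r → Fin n → A) (hr : 0 < r) (d : ℕ) (hn : n = d + r - 1) (hd : 2 ≤ d)
    (hcol : ∀ p : Ideal A, p.IsPrime → p ≠ maximalIdeal A →
      ∃ J : Fin r → Fin n, Function.Injective J ∧ (mJ φ J).det ∉ p)
    (h1 : DP ((maximalIdeal A).map (C (σ := Fin n))) d (MvPolynomial (Fin n) A))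
    (I : Ideal (MvPolynomial (Fin n) A)) (h2 : DP I (d + 1) (MvPolynomial (Fin n) A)) :
    DP ((maximalIdeal A).map (C (σ := Fin n))) 1 ((Fin (r + 1) → MvPolynomial (Fin n) A) ⧸
      LinearMap.range (gmap (W := MvPolynomial (Fin n) A) (rowF φ) (r + 1))) ∧
    DP I 2 ((Fin (r + 1) → MvPolynomial (Fin n) A) ⧸
      LinearMap.range (gmap (W := MvPolynomial (Fin n) A) (rowF φ) (r + 1))) := by
  have hinj0 : ∀ q < r + 1, ∀ m, r + 1 ≤ m + 1 →
      DP ((maximalIdeal A).map (C (σ := Fin n))) 1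
        (Yq (MvPolynomial (Fin n) A) (rowF φ) (q + 1) (m + 1)) →
      ∀ x ∈ Lsub (MvPolynomial (Fin n) A) n (MvPolynomial (Fin n) A) (m + 1),
      ctr (MvPolynomial (Fin n) A) (rowF φ q) x ∈ Zsub (MvPolynomial (Fin n) A) (rowF φ) q m →
      x ∈ Zsub (MvPolynomial (Fin n) A) (rowF φ) (q + 1) (m + 1) := by
    intro q hq m hm hDP x hx hz
    have := TL_sub hcol hDP (Submodule.Quotient.mk ⟨x, hx⟩) (by
      intro J hJ
      obtain ⟨W, _, _, ι, hW, hker, hsurj⟩ := exists_W φ J hJ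
      have hall := W_all φ J hr (by omega) hW
      have h4 := hall.2.1 q hq m hm (eMap ι x) (eMap_Lsub ι hx)
        (by rw [← eMap_ctr]; exact eMap_Zsub ι _ hz)
      obtain ⟨N, hN⟩ := torsion_of_Z hker hsurj (rowF φ) h4
      refine ⟨N, ?_⟩
      rw [← Submodule.Quotient.mk_smul, Submodule.Quotient.mk_eq_zero]
      exact hN)
    rw [Submodule.Quotient.mk_eq_zero] at this
    exact this
  have hT1 := T1 (Q := r + 1) h1 (m0 := r + 1) (by omega) hinj0
  have hinj : ∀ q < r + 1, ∀ m, r + 1 ≤ m + 1 →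
      ∀ x ∈ Lsub (MvPolynomial (Fin n) A) n (MvPolynomial (Fin n) A) (m + 1),
      ctr (MvPolynomial (Fin n) A) (rowF φ q) x ∈ Zsub (MvPolynomial (Fin n) A) (rowF φ) q m →
      x ∈ Zsub (MvPolynomial (Fin n) A) (rowF φ) (q + 1) (m + 1) := by
    intro q hq m hm
    exact hinj0 q hq m hm (hT1 (m + 1) hm (q + 1) (by omega) 1 (by omega))
  have hT2 := T1 (Q := r + 1) h2 (m0 := r + 1) (by omega) (fun q hq m hm _ => hinj q hq m hm)
  have ha : ∀ x ∈ Lsub (MvPolynomial (Fin n) A) n (MvPolynomial (Fin n) A) (1 + (r + 1)),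
      Del (MvPolynomial (Fin n) A) (rowF φ) (r + 1) x = 0 →
      x ∈ Zsub (MvPolynomial (Fin n) A) (rowF φ) (r + 1) (1 + (r + 1)) := by
    intro x hx hz
    have := TL_sub hcol (hT1 (1 + (r + 1)) (by omega) (r + 1) le_rfl 1 (by omega))
      (Submodule.Quotient.mk ⟨x, hx⟩) (by
      intro J hJ
      obtain ⟨W, _, _, ι, hW, hker, hsurj⟩ := exists_W φ J hJ
      have hall := W_all φ J hr (by omega) hW
      have h4 := hall.2.2.1 (eMap ι x) (eMap_Lsub ι hx)
        (by rw [← eMap_Del, hz, map_zero])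
      obtain ⟨N, hN⟩ := torsion_of_Z hker hsurj (rowF φ) h4
      refine ⟨N, ?_⟩
      rw [← Submodule.Quotient.mk_smul, Submodule.Quotient.mk_eq_zero]
      exact hN)
    rw [Submodule.Quotient.mk_eq_zero] at this
    exact this
  have hb : ∀ x ∈ Lsub (MvPolynomial (Fin n) A) n (MvPolynomial (Fin n) A) 1,
      (∀ i < r + 1, ctr (MvPolynomial (Fin n) A) (rowF φ i) x = 0) →
      x ∈ imD (MvPolynomial (Fin n) A) (rowF φ) (r + 1) := by
    intro x hx hz
    have hc := DP.coker (k := 1) ha (hT1 (1 + (r + 1)) (by omega) (r + 1) le_rfl 2 (by omega))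
      (h1.mono (by omega))
    have := TL_sub hcol hc (Submodule.Quotient.mk ⟨x, hx⟩) (by
      intro J hJ
      obtain ⟨W, _, _, ι, hW, hker, hsurj⟩ := exists_W φ J hJ
      have hall := W_all φ J hr (by omega) hW
      obtain ⟨w, hw, hwx⟩ := hall.2.2.2 (by omega) (eMap ι x) (eMap_Lsub ι hx)
        (by intro i hi; rw [← eMap_ctr, hz i hi, map_zero])
      obtain ⟨N, z, hz, hN⟩ := torsion_of_Del hker hsurj (rowF φ) hw hwx.symm
      refine ⟨N, ?_⟩
      rw [← Submodule.Quotient.mk_smul, Submodule.Quotient.mk_eq_zero]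
      exact ⟨z, hz, hN.symm⟩)
    rw [Submodule.Quotient.mk_eq_zero] at this
    exact this
  exact ⟨DP.coker2 ha hb (hT1 (1 + (r + 1)) (by omega) (r + 1) le_rfl 3 (by omega))
      (h1.mono (by omega)),
    DP.coker2 ha hb (hT2 (1 + (r + 1)) (by omega) (r + 1) le_rfl 4 (by omega))
      (h2.mono (by omega))⟩

end BStep


section Theta
variable {A : Type} [CommRing A] {n r : ℕ}

/-- the presentation map of the Rees algebra -/
noncomputable def thetaF (φ : Fin r → Fin n → A) :
    MvPolynomial (Fin n) A →ₐ[A] MvPolynomial (Fin r) A :=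
  aeval fun q => ∑ i, C (φ i q) * X i

lemma thetaF_X (φ : Fin r → Fin n → A) (q : Fin n) :
    thetaF φ (X q) = ∑ i, C (φ i q) * X i := by simp [thetaF]

lemma thetaF_C (φ : Fin r → Fin n → A) (a : A) : thetaF φ (C a) = C a := by
  simp [thetaF, algebraMap_eq]

/-- lifts of `b t_i` -/
noncomputable def tauJ (φ : Fin r → Fin n → A) (J : Fin r → Fin n) (i : Fin r) :
    MvPolynomial (Fin n) A := ∑ q, C (cJ φ J i q) * X q

lemma thetaF_tau (φ : Fin r → Fin n → A) (J : Fin r → Fin n) (i : Fin r) :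
    thetaF φ (tauJ φ J i) = C (mJ φ J).det * X i := by
  simp only [tauJ, map_sum, map_mul, thetaF_C, thetaF_X, Finset.mul_sum]
  rw [Finset.sum_comm]
  have : ∀ j : Fin r, ∑ q, C (cJ φ J i q) * (C (φ j q) * X j) =
      (C (∑ q, φ j q * cJ φ J i q) * X j : MvPolynomial (Fin r) A) := by
    intro j
    simp only [map_sum, Finset.sum_mul, C_mul]
    exact Finset.sum_congr rfl fun q _ => by ring
  simp only [this, phi_cJ]
  rw [Finset.sum_eq_single i]
  · simp
  · intro j _ hj; simp [hj]
  · simp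

lemma lamJ_tau (φ : Fin r → Fin n → A) (J : Fin r → Fin n) (p : Fin n) :
    lamJ φ J p = C (mJ φ J).det * X p - ∑ i, C (φ i p) * tauJ φ J i := by
  rw [lamJ_eq]
  congr 1
  have : ∀ i, tauJ φ J i = ∑ k, C ((mJ φ J).adjugate k i) * X (J k) := by
    intro i
    simp only [tauJ, cJ, map_sum, Finset.sum_mul]
    rw [Finset.sum_comm]
    refine Finset.sum_congr rfl fun k _ => ?_
    rw [Finset.sum_eq_single (J k)]
    · simp
    · intro q _ hq; simp [hq]
    · simp
  simp only [this, Finset.mul_sum, aJ, map_sum, Finset.sum_mul]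
  rw [Finset.sum_comm]
  refine Finset.sum_congr rfl fun i _ => Finset.sum_congr rfl fun k _ => ?_
  rw [C_mul]; ring

lemma ker_torsion (φ : Fin r → Fin n → A) (J : Fin r → Fin n)
    (Q : Ideal (MvPolynomial (Fin n) A)) (hQ : ∀ p, lamJ φ J p ∈ Q)
    (p : MvPolynomial (Fin n) A) (hp : thetaF φ p = 0) :
    ∃ N : ℕ, C (mJ φ J).det ^ N * p ∈ Q := by
  let bb : MvPolynomial (Fin n) A ⧸ Q := Ideal.Quotient.mk Q (C (mJ φ J).det)
  let L := Localization.Away bb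
  let can : MvPolynomial (Fin n) A →+* L :=
    (algebraMap (MvPolynomial (Fin n) A ⧸ Q) L).comp (Ideal.Quotient.mk Q)
  let v : L := IsLocalization.Away.invSelf bb
  have hv : can (C (mJ φ J).det) * v = 1 := IsLocalization.Away.mul_invSelf bb
  let g : MvPolynomial (Fin r) A →+* L :=
    eval₂Hom (can.comp C) (fun i => v * can (tauJ φ J i))
  have hg : g.comp (thetaF φ : MvPolynomial (Fin n) A →+* MvPolynomial (Fin r) A) = can := by
    apply MvPolynomial.ringHom_ext
    · intro a
      show g (thetaF φ (C a)) = _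
      rw [thetaF_C]
      simp [g]
    · intro q
      show g (thetaF φ (X q)) = _
      rw [thetaF_X]
      have h1 : can (C (mJ φ J).det) * can (X q) = ∑ i, can (C (φ i q)) * can (tauJ φ J i) := by
        have : can (lamJ φ J q) = 0 := by
          show algebraMap _ L (Ideal.Quotient.mk Q _) = 0
          rw [Ideal.Quotient.eq_zero_iff_mem.2 (hQ q), map_zero]
        rw [lamJ_tau, map_sub, sub_eq_zero] at this
        simpa using this
      have h2 : g (∑ i, C (φ i q) * X i) = v * ∑ i, can (C (φ i q)) * can (tauJ φ J i) := by
        simp only [map_sum, map_mul, Finset.mul_sum, g]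
        refine Finset.sum_congr rfl fun i _ => ?_
        simp only [coe_eval₂Hom, eval₂_C, eval₂_X, RingHom.comp_apply]
        ring
      rw [h2, ← h1, ← mul_assoc, mul_comm v, hv, one_mul]
  have h0 : can p = 0 := by
    rw [← hg]
    show g (thetaF φ p) = 0
    rw [hp, map_zero]
  obtain ⟨⟨c, N, hN⟩, hc⟩ := (IsLocalization.map_eq_zero_iff (Submonoid.powers bb) L _).1 h0
  refine ⟨N, ?_⟩
  rw [← Ideal.Quotient.eq_zero_iff_mem, map_mul, map_pow]
  simp only at hN hc
  rw [← hN] at hc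
  exact hc

lemma coker_torsion (φ : Fin r → Fin n → A) (J : Fin r → Fin n) (x : MvPolynomial (Fin r) A) :
    ∃ N : ℕ, C (mJ φ J).det ^ N * x ∈ (thetaF φ).range := by
  have hC : ∀ a : A, (C a : MvPolynomial (Fin r) A) ∈ (thetaF φ).range :=
    fun a => ⟨C a, thetaF_C φ a⟩
  induction x using MvPolynomial.induction_on with
  | C a => exact ⟨0, by simpa using hC a⟩
  | add p q hp hq =>
    obtain ⟨N, hN⟩ := hp
    obtain ⟨K, hK⟩ := hq
    refine ⟨N + K, ?_⟩
    rw [show C (mJ φ J).det ^ (N + K) * (p + q) = C (mJ φ J).det ^ K * (C (mJ φ J).det ^ N * p) +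
      C (mJ φ J).det ^ N * (C (mJ φ J).det ^ K * q) by ring]
    exact add_mem (mul_mem (pow_mem (hC _) _) hN) (mul_mem (pow_mem (hC _) _) hK)
  | mul_X p i hp =>
    obtain ⟨N, hN⟩ := hp
    refine ⟨N + 1, ?_⟩
    rw [show C (mJ φ J).det ^ (N + 1) * (p * X i) =
      (C (mJ φ J).det ^ N * p) * (C (mJ φ J).det * X i) by ring]
    exact mul_mem hN ⟨_, thetaF_tau φ J i⟩

/-- the map `B^{r+1} → S` -/
noncomputable def piF (φ : Fin r → Fin n → A) (y : Fin (r + 1) → MvPolynomial (Fin n) A) :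
    MvPolynomial (Fin r) A :=
  ∑ i : Fin r, thetaF φ (y i.castSucc) * X i - thetaF φ (y (Fin.last r))

lemma rowF_castSucc (φ : Fin r → Fin n → A) (i : Fin r) (q) :
    rowF φ (i.castSucc : Fin (r + 1)) q = C (φ i q) := by
  simp [rowF]

lemma rowF_last (φ : Fin r → Fin n → A) (q) :
    rowF φ (Fin.last r : Fin (r + 1)) q = X q := by
  simp [rowF]

lemma thetaF_cols (φ : Fin r → Fin n → A) (c : Fin n → MvPolynomial (Fin n) A) :
    ∑ i : Fin r, thetaF φ (∑ q, C (φ i q) * c q) * X i = thetaF φ (∑ q, X q * c q) := by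
  simp only [map_sum, map_mul, thetaF_C, thetaF_X, Finset.sum_mul]
  rw [Finset.sum_comm]
  refine Finset.sum_congr rfl fun q _ => Finset.sum_congr rfl fun i _ => ?_
  ring

lemma piF_range (φ : Fin r → Fin n → A) (y)
    (hy : y ∈ LinearMap.range (gmap (W := MvPolynomial (Fin n) A) (rowF φ) (r + 1))) :
    piF φ y = 0 := by
  obtain ⟨c, hc⟩ := (mem_range_gmap _ _ _).1 hy
  simp only [piF, hc, rowF_castSucc, rowF_last, smul_eq_mul]
  rw [thetaF_cols, sub_self]

lemma piF_torsion (φ : Fin r → Fin n → A) (J : Fin r → Fin n) (y) (hy : piF φ y = 0) :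
    ∃ N : ℕ, (C (mJ φ J).det : MvPolynomial (Fin n) A) ^ N • y ∈
      LinearMap.range (gmap (W := MvPolynomial (Fin n) A) (rowF φ) (r + 1)) := by
  set G := LinearMap.range (gmap (W := MvPolynomial (Fin n) A) (rowF φ) (r + 1)) with hG
  let el : MvPolynomial (Fin n) A →ₗ[MvPolynomial (Fin n) A] (Fin (r + 1) → MvPolynomial (Fin n) A) :=
    LinearMap.single _ (fun _ : Fin (r + 1) => MvPolynomial (Fin n) A) (Fin.last r)
  let p := C (mJ φ J).det * y (Fin.last r) - ∑ i : Fin r, tauJ φ J i * y i.castSucc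
  obtain ⟨N, hN⟩ := ker_torsion φ J (G.comap el) (by
    intro p
    refine (mem_range_gmap _ _ _).2 ⟨fun q => C (vJ φ J p q), fun i => ?_⟩
    simp only [smul_eq_mul]
    induction i using Fin.lastCases with
    | last =>
      rw [Fin.val_last, rowF_vJ_last]
      simp [el]
    | cast i =>
      rw [Fin.val_castSucc, rowF_vJ φ J i i.2]
      simp [el]) p (by
    simp only [p, map_sub, map_mul, map_sum, thetaF_tau, thetaF_C]
    have : C (mJ φ J).det * piF φ y = 0 := by rw [hy, mul_zero]
    rw [piF, mul_sub, Finset.mul_sum] at this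
    rw [← neg_eq_zero, neg_sub, ← this]
    congr 1
    exact Finset.sum_congr rfl fun i _ => by ring)
  refine ⟨N + 1, ?_⟩
  have hby : (C (mJ φ J).det : MvPolynomial (Fin n) A) • y - el p ∈ G := by
    refine (mem_range_gmap _ _ _).2 ⟨fun q => ∑ i : Fin r, C (cJ φ J i q) * y i.castSucc,
      fun j => ?_⟩
    have e : ∑ q, rowF φ j q • ∑ i : Fin r, C (cJ φ J i q) * y i.castSucc =
        ∑ i : Fin r, (∑ q, rowF φ j q * C (cJ φ J i q)) * y i.castSucc := by
      simp only [smul_eq_mul, Finset.mul_sum, Finset.sum_mul]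
      rw [Finset.sum_comm]
      exact Finset.sum_congr rfl fun i _ => Finset.sum_congr rfl fun q _ => by ring
    rw [e]
    induction j using Fin.lastCases with
    | last =>
      simp only [rowF_last]
      simp [el, p, tauJ, mul_comm]
    | cast j =>
      simp only [rowF_castSucc, ← C_mul, ← map_sum, phi_cJ]
      rw [Finset.sum_eq_single j]
      · simp [el]
      · intro i _ hi; simp [Ne.symm hi]
      · simp
  have h2 := G.smul_mem ((C (mJ φ J).det : MvPolynomial (Fin n) A) ^ N) hby
  have h3 : el (C (mJ φ J).det ^ N * p) ∈ G := hN
  rw [smul_sub, ← map_smul, smul_eq_mul, smul_smul, ← pow_succ] at h2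
  have := add_mem h2 h3
  rwa [sub_add_cancel] at this

lemma lamJ_zero (φ : Fin r → Fin n → A) (J : Fin r → Fin n) (hJ : Function.Surjective J)
    (p : Fin n) : lamJ φ J p = 0 := by
  obtain ⟨k, rfl⟩ := hJ p
  rw [lamJ_eq]
  have : ∀ j, aJ φ J (J k) j = if j = k then (mJ φ J).det else 0 := by
    intro j
    have h : aJ φ J (J k) j = ((mJ φ J).adjugate * mJ φ J) j k := by
      simp [aJ, Matrix.mul_apply, mJ]
    rw [h, Matrix.adjugate_mul]
    simp [Matrix.one_apply]
  rw [Finset.sum_eq_single k]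
  · simp [this]
  · intro j _ hj; simp [this, hj]
  · simp

lemma divide_cols (φ : Fin r → Fin n → A) (s : Fin n) (m : ℕ)
    (y : Fin r → MvPolynomial (Fin n) A) (c : Fin n → MvPolynomial (Fin n) A)
    (h : ∀ i, X s ^ m * y i = ∑ q, C (φ i q) * c q) :
    ∃ c' : Fin n → MvPolynomial (Fin n) A, ∀ i, y i = ∑ q, C (φ i q) * c' q := by
  refine ⟨fun q => (c q).divMonomial (Finsupp.single s m), fun i => ?_⟩
  ext e
  have := congrArg (coeff (Finsupp.single s m + e)) (h i)
  rw [X_pow_eq_monomial, coeff_monomial_mul, one_mul] at this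
  rw [this]
  simp [coeff_sum, coeff_C_mul, coeff_divMonomial]

end Theta

section Sat
variable {A B S : Type} [CommRing A] [IsLocalRing A] [IsNoetherianRing A] [CommRing B]
  [AddCommGroup S] [Module B S]

lemma sat_mem (f : A →+* B) (s : B) (V : Submodule B S)
    (hV : DP ((maximalIdeal A).map f ⊔ Ideal.span {s}) 2 V)
    (hS : DP ((maximalIdeal A).map f ⊔ Ideal.span {s}) 1 S) (x : S)
    (hx : ∀ p : Ideal A, p.IsPrime → p ≠ maximalIdeal A → ∃ b ∉ p, ∃ N : ℕ, f b ^ N • x ∈ V)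
    (m : ℕ) (hm : s ^ m • x ∈ V) : x ∈ V := by
  have hQ : DP ((maximalIdeal A).map f ⊔ Ideal.span {s}) 1 (S ⧸ V) :=
    DP.ses V.subtype V.mkQ V.injective_subtype V.mkQ_surjective
      (LinearMap.exact_subtype_mkQ V) hV hS
  induction m with
  | zero => simpa using hm
  | succ m ih =>
    apply ih
    rw [← Submodule.Quotient.mk_eq_zero]
    refine TL f _ ?_ ?_
    · intro p hp hpm
      obtain ⟨b, hb, N, hN⟩ := hx p hp hpm
      refine ⟨b, hb, N, ?_⟩
      rw [← Submodule.Quotient.mk_smul, Submodule.Quotient.mk_eq_zero, smul_comm]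
      exact V.smul_mem _ hN
    · intro a ha
      refine hQ.one _ fun u hu => ?_
      have : (maximalIdeal A).map f ⊔ Ideal.span {s} ≤
          LinearMap.ker (LinearMap.toSpanSingleton B (S ⧸ V)
            (f a • (Submodule.Quotient.mk (s ^ m • x) : S ⧸ V))) := by
        refine sup_le (Ideal.span_le.2 ?_) (Ideal.span_le.2 ?_)
        · rintro _ ⟨v, hv, rfl⟩
          exact ha v hv
        · intro v hv
          obtain rfl : v = s := hv
          show v • f a • (Submodule.Quotient.mk (v ^ m • x) : S ⧸ V) = 0
          rw [smul_comm, ← Submodule.Quotient.mk_smul, smul_smul, ← pow_succ',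
            (Submodule.Quotient.mk_eq_zero V).2 hm, smul_zero]
      exact this hu

end Sat


section Core
variable {A : Type} [CommRing A] [IsLocalRing A] [IsNoetherianRing A] {n r : ℕ}

theorem core_mem (φ : Fin r → Fin n → A) (hr : 0 < r) (d : ℕ) (hd0 : 0 < d)
    (hn : n = d + r - 1)
    (hcol : ∀ p : Ideal A, p.IsPrime → p ≠ maximalIdeal A →
      ∃ J : Fin r → Fin n, Function.Injective J ∧ (mJ φ J).det ∉ p)
    (rs : List A) (hrs : ∀ u ∈ rs, u ∈ maximalIdeal A)
    (hreg : RingTheory.Sequence.IsWeaklyRegular A rs) (hlen : rs.length = d)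
    (s : Fin n) (m : ℕ) (x : MvPolynomial (Fin r) A)
    (hx : thetaF φ (X s) ^ m * x ∈ (thetaF φ).range) : x ∈ (thetaF φ).range := by
  let _ : Module (MvPolynomial (Fin n) A) (MvPolynomial (Fin r) A) :=
    Module.compHom _ (thetaF φ : MvPolynomial (Fin n) A →+* MvPolynomial (Fin r) A)
  have hsm : ∀ (b : MvPolynomial (Fin n) A) (y : MvPolynomial (Fin r) A),
    b • y = thetaF φ b * y := fun _ _ => rfl
  let mB : Ideal (MvPolynomial (Fin n) A) := (maximalIdeal A).map (C (σ := Fin n))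
  let I : Ideal (MvPolynomial (Fin n) A) := mB ⊔ Ideal.span {X s}
  have hBm : DP mB d (MvPolynomial (Fin n) A) := by
    have := DP.of_regular (I := mB) (rs.map (C : A → MvPolynomial (Fin n) A)) _ (by
      intro u hu
      obtain ⟨a, ha, rfl⟩ := List.mem_map.1 hu
      exact Ideal.mem_map_of_mem _ (hrs a ha)) (weaklyRegular_C rs hreg)
    simpa [hlen] using this
  have hBI : DP I (d + 1) (MvPolynomial (Fin n) A) := by
    have := DP.of_regular (I := I) (rs.map (C : A → MvPolynomial (Fin n) A) ++ [X s]) _ (by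
      intro u hu
      rcases List.mem_append.1 hu with hu | hu
      · obtain ⟨a, ha, rfl⟩ := List.mem_map.1 hu
        exact Ideal.mem_sup_left (Ideal.mem_map_of_mem _ (hrs a ha))
      · rw [List.mem_singleton] at hu
        subst hu
        exact Ideal.mem_sup_right (Ideal.mem_span_singleton_self _)) (weaklyRegular_CX rs hreg s)
    simpa [hlen] using this
  have hS : DP I 1 (MvPolynomial (Fin r) A) := by
    refine DP.of_one fun y hy => ?_
    cases rs with
    | nil => simp at hlen; omega
    | cons u rs =>
      have h1 := weaklyRegular_C (σ := Fin r) (u :: rs) hreg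
      rw [List.map_cons, RingTheory.Sequence.isWeaklyRegular_cons_iff] at h1
      have h2 := hy (C u) (Ideal.mem_sup_left (Ideal.mem_map_of_mem _ (hrs u (by simp))))
      rw [hsm, thetaF_C] at h2
      exact h1.1 (by simpa using h2)
  have htor : ∀ p : Ideal A, p.IsPrime → p ≠ maximalIdeal A → ∃ b ∉ p, ∃ N : ℕ,
      (C b : MvPolynomial (Fin n) A) ^ N • x ∈ (thetaF φ).range := by
    intro p hp hpm
    obtain ⟨J, -, hJp⟩ := hcol p hp hpm
    obtain ⟨N, hN⟩ := coker_torsion φ J x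
    refine ⟨_, hJp, N, ?_⟩
    rwa [hsm, map_pow, thetaF_C]
  by_cases hd1 : d = 1
  · have hnr : n = r := by omega
    let T : MvPolynomial (Fin n) A →ₗ[MvPolynomial (Fin n) A] MvPolynomial (Fin r) A :=
      { toFun := thetaF φ
        map_add' := map_add _
        map_smul' := fun b y => map_mul _ _ _ }
    have hinj : Function.Injective T := by
      rw [injective_iff_map_eq_zero]
      intro y hy
      refine TL_sub hcol (hBm.mono (by omega)) y fun J hJ => ?_
      have hsurj : Function.Surjective J :=
        ((Fintype.bijective_iff_injective_and_card J).2 ⟨hJ, by simp [hnr]⟩).2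
      obtain ⟨N, hN⟩ := ker_torsion φ J ⊥ (fun p => lamJ_zero φ J hsurj p) y hy
      exact ⟨N, hN⟩
    have hV : DP I 2 (LinearMap.range T) :=
      (hBI.mono (by omega)).equiv (LinearEquiv.ofInjective T hinj)
    refine sat_mem (C : A →+* MvPolynomial (Fin n) A) (X s) (LinearMap.range T) hV hS x htor m ?_
    rw [hsm, map_pow]
    exact hx
  · obtain ⟨hN1, hN2⟩ := B_all φ hr d hn (by omega) hcol hBm I hBI
    let T : (Fin (r + 1) → MvPolynomial (Fin n) A) →ₗ[MvPolynomial (Fin n) A]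
        MvPolynomial (Fin r) A :=
      { toFun := piF φ
        map_add' := fun y z => by
          simp only [piF, Pi.add_apply, map_add, add_mul, Finset.sum_add_distrib]
          ring
        map_smul' := fun b y => by
          simp only [piF, Pi.smul_apply, smul_eq_mul, map_mul, hsm, mul_sub, Finset.mul_sum,
            mul_assoc, RingHom.id_apply] }
    have hker : LinearMap.ker T =
        LinearMap.range (gmap (W := MvPolynomial (Fin n) A) (rowF φ) (r + 1)) := by
      apply le_antisymm
      · intro y hy
        rw [← Submodule.Quotient.mk_eq_zero]
        refine TL_sub hcol hN1 _ fun J hJ => ?_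
        obtain ⟨N, hN⟩ := piF_torsion φ J y hy
        refine ⟨N, ?_⟩
        rw [← Submodule.Quotient.mk_smul, Submodule.Quotient.mk_eq_zero]
        exact hN
      · intro y hy
        exact piF_range φ y hy
    have hV : DP I 2 (LinearMap.range T) := by
      rw [← hker] at hN2
      exact hN2.equiv T.quotKerEquivRange
    have hle : ∀ z ∈ (thetaF φ).range, z ∈ LinearMap.range T := by
      rintro _ ⟨b, rfl⟩
      refine ⟨Pi.single (Fin.last r) (-b), ?_⟩
      show piF φ _ = _
      simp [piF]
    have hxV : x ∈ LinearMap.range T := by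
      refine sat_mem (C : A →+* MvPolynomial (Fin n) A) (X s) (LinearMap.range T) hV hS x ?_ m ?_
      · intro p hp hpm
        obtain ⟨b, hb, N, hN⟩ := htor p hp hpm
        exact ⟨b, hb, N, hle _ hN⟩
      · rw [hsm, map_pow]
        exact hle _ hx
    obtain ⟨y, rfl⟩ := hxV
    obtain ⟨z, hz⟩ := hx
    change thetaF φ z = _ at hz
    have h0 : (X s : MvPolynomial (Fin n) A) ^ m • y + Pi.single (Fin.last r) z ∈ LinearMap.ker T := by
      rw [LinearMap.mem_ker, map_add, map_smul, hsm, map_pow, ← hz]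
      show _ + piF φ _ = 0
      simp [piF]
    rw [hker, mem_range_gmap] at h0
    obtain ⟨c, hc⟩ := h0
    obtain ⟨c', hc'⟩ := divide_cols φ s m (fun i => y i.castSucc) c (fun i => by
      have := hc i.castSucc
      simp only [rowF_castSucc, smul_eq_mul] at this
      rw [← this]
      simp)
    refine ⟨∑ q, X q * c' q - y (Fin.last r), ?_⟩
    show thetaF φ _ = piF φ y
    rw [map_sub, ← thetaF_cols, piF]
    simp only [← hc']

end Core


section Cols
variable {A : Type} [CommRing A] [IsLocalRing A] [IsNoetherianRing A] {n r : ℕ}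

lemma pow_le_of_len {Q : Type} [AddCommGroup Q] [Module A Q] [Module.Finite A Q]
    (k : ℕ) (h : Order.krullDim (Submodule A Q) = (k : WithBot ℕ∞)) :
    ∃ N : ℕ, (maximalIdeal A ^ N) • (⊤ : Submodule A Q) = ⊥ := by
  have h1 : Module.length A Q ≠ ⊤ := by
    intro h2
    rw [← Module.coe_length, h2] at h
    exact absurd (WithBot.coe_injective h) (ENat.top_ne_natCast k)
  rw [Module.length_ne_top_iff, isFiniteLength_iff_isNoetherian_isArtinian] at h1
  have := h1.2
  obtain ⟨N, hN⟩ := IsArtinian.monotone_stabilizes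
    (⟨fun N => OrderDual.toDual ((maximalIdeal A ^ N) • (⊤ : Submodule A Q)), fun a b hab =>
      Submodule.smul_mono_left (Ideal.pow_le_pow_right hab)⟩ : ℕ →o (Submodule A Q)ᵒᵈ)
  refine ⟨N, ?_⟩
  have h2 : (maximalIdeal A ^ N) • (⊤ : Submodule A Q) =
      (maximalIdeal A ^ (N + 1)) • (⊤ : Submodule A Q) := hN (N + 1) (Nat.le_succ N)
  refine Submodule.eq_bot_of_le_smul_of_le_jacobson_bot (maximalIdeal A) _
    (IsNoetherian.noetherian _) ?_ (IsLocalRing.maximalIdeal_le_jacobson _)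
  rw [← Submodule.smul_assoc, smul_eq_mul, ← pow_succ', ← h2]

lemma cols_exist (M : Submodule A (Fin r → A)) (k : ℕ)
    (hlen : Order.krullDim (Submodule A ((Fin r → A) ⧸ M)) = (k : WithBot ℕ∞))
    (g : Fin n → (Fin r → A)) (hg : Submodule.span A (Set.range g) = M)
    (p : Ideal A) (hp : p.IsPrime) (hpm : p ≠ maximalIdeal A) :
    ∃ J : Fin r → Fin n, Function.Injective J ∧ (mJ (fun i q => g q i) J).det ∉ p := by
  obtain ⟨N, hN⟩ := pow_le_of_len k hlen
  obtain ⟨b, hbm, hbp⟩ : ∃ b ∈ maximalIdeal A, b ∉ p := by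
    by_contra hcon
    push Not at hcon
    exact hpm (le_antisymm (IsLocalRing.le_maximalIdeal hp.ne_top) hcon)
  have hbF : ∀ v : Fin r → A, b ^ N • v ∈ M := by
    intro v
    rw [← Submodule.Quotient.mk_eq_zero, Submodule.Quotient.mk_smul]
    rw [← Submodule.mem_bot A, ← hN]
    exact Submodule.smul_mem_smul (Ideal.pow_mem_pow hbm N) trivial
  have hc : ∀ i : Fin r, ∃ c : Fin n → A, ∑ q, c q • g q = b ^ N • Pi.single i 1 := by
    intro i
    have := hbF (Pi.single i 1)
    rw [← hg] at this
    exact (Submodule.mem_span_range_iff_exists_fun A).1 this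
  choose c hc using hc
  by_contra hcon
  push Not at hcon
  have key : Matrix.detRowAlternating (R := A) (fun i : Fin r => ∑ q, c i q • g q) ∈ p := by
    rw [← AlternatingMap.coe_multilinearMap, MultilinearMap.map_sum]
    refine Ideal.sum_mem _ fun J _ => ?_
    rw [MultilinearMap.map_smul_univ, smul_eq_mul]
    refine Ideal.mul_mem_left _ _ ?_
    by_cases hJ : Function.Injective J
    · have := hcon J hJ
      rw [← Matrix.det_transpose] at this
      exact this
    · rw [Function.not_injective_iff] at hJ
      obtain ⟨a, a', h1, h2⟩ := hJ
      rw [AlternatingMap.coe_multilinearMap, AlternatingMap.map_eq_zero_of_eq _ _ (by simp [h1]) h2]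
      exact zero_mem _
  simp only [hc] at key
  have h3 : Matrix.detRowAlternating (R := A) (fun i : Fin r => b ^ N • Pi.single i 1) =
      (b ^ N) ^ r := by
    rw [← AlternatingMap.coe_multilinearMap, MultilinearMap.map_smul_univ]
    have : (fun i : Fin r => (Pi.single i 1 : Fin r → A)) = (1 : Matrix (Fin r) (Fin r) A) := by
      ext i j
      simp [Matrix.one_apply, Pi.single_apply, eq_comm]
    rw [this]
    show (∏ i : Fin r, b ^ N) • Matrix.det 1 = _
    simp
  rw [h3] at key
  exact hbp (hp.mem_of_pow_mem _ (hp.mem_of_pow_mem _ key))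

end Cols

section Final

lemma rees_range (A : Type) [CommRing A] (r n : ℕ) (M : Submodule A (Fin r → A))
    (g : Fin n → (Fin r → A)) (hg : Submodule.span A (Set.range g) = M) :
    reesAlg A r M = (thetaF (fun i q => g q i)).range := by
  have h : ∀ q, emb A r (g q) = ∑ i, C (g q i) * X i := by
    intro q
    simp [emb, Fintype.linearCombination_apply, smul_eq_C_mul]
  rw [thetaF, ← Algebra.adjoin_range_eq_range_aeval]
  have h2 : (fun q => ∑ i, C (g q i) * X i) = fun q => emb A r (g q) := by
    ext1 q; rw [h]
  rw [h2, reesAlg, sub1, ← hg, Submodule.map_span, Algebra.adjoin_span, ← Set.range_comp]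
  rfl

lemma rees_lin (A : Type) [CommRing A] (r : ℕ) (M : Submodule A (Fin r → A))
    (v : Fin r → A) (hv : emb A r v ∈ reesAlg A r M) : v ∈ M := by
  let ev : MvPolynomial (Fin r) A →ₐ[A] TrivSqZeroExt A (Fin r → A) :=
    aeval fun i => TrivSqZeroExt.inr (Pi.single i 1)
  have he : ∀ w : Fin r → A, ev (emb A r w) = TrivSqZeroExt.inr w := by
    intro w
    simp only [emb, Fintype.linearCombination_apply, map_sum, map_smul, ev, aeval_X]
    simp only [← TrivSqZeroExt.inr_smul, ← TrivSqZeroExt.inr_sum]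
    congr 1
    ext j
    simp [Pi.single_apply]
  have key : ∀ z ∈ reesAlg A r M, (ev z).snd ∈ M := by
    intro z hz
    induction hz using Algebra.adjoin_induction with
    | mem z hz =>
      obtain ⟨w, hw, rfl⟩ := hz
      rw [he]
      exact hw
    | algebraMap a =>
      rw [AlgHom.commutes]
      show (0 : Fin r → A) ∈ M
      exact zero_mem _
    | add z w _ _ h1 h2 =>
      rw [map_add, TrivSqZeroExt.snd_add]
      exact add_mem h1 h2
    | mul z w _ _ h1 h2 =>
      rw [map_mul, TrivSqZeroExt.snd_mul, op_smul_eq_smul]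
      exact add_mem (M.smul_mem _ h2) (M.smul_mem _ h1)
  have := key _ hv
  rwa [he] at this

end Final

theorem ratliffRush_statement_6 (A : Type) [CommRing A] [IsLocalRing A]
    [IsNoetherianRing A] (hCM : IsCohenMacaulayLocalRing A)
    (d : ℕ) (hd : ringKrullDim A = d) (hd0 : 0 < d)
    (r : ℕ) (hr : 0 < r) (M : Submodule A (Fin r → A))
    (hlen : ∃ n : ℕ, modLength A ((Fin r → A) ⧸ M) = (n : WithBot ℕ∞))
    (hmF : M ≤ (maximalIdeal A) • (⊤ : Submodule A (Fin r → A)))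
    (hgen : minGen A M = d + r - 1) :
    rrAlg A r (reesAlg A r M) = reesAlg A r M ∧
    ratliffRush A r (freeSub A r) (sub1 A r M) = sub1 A r M := by
  obtain ⟨n, hn⟩ : ∃ n, n = d + r - 1 := ⟨_, rfl⟩
  have hn0 : 0 < n := by omega
  obtain ⟨g, hg⟩ : ∃ g : Fin n → (Fin r → A), Submodule.span A (Set.range g) = M := by
    rw [← hn, minGen] at hgen
    have := Nat.sInf_mem (Nat.nonempty_of_pos_sInf (hgen ▸ hn0))
    rw [hgen] at this
    exact this
  obtain ⟨k, hk⟩ := hlen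
  obtain ⟨rs, hrs, hreg, hrl⟩ := hCM
  have hrl : rs.length = d := by
    rw [hd] at hrl
    exact_mod_cast hrl
  let s : Fin n := ⟨0, hn0⟩
  have hR := rees_range A r n M g hg
  have hfs : thetaF (fun i q => g q i) (X s) ∈ sub1 A r M := by
    refine ⟨g s, ?_, ?_⟩
    · rw [← hg]; exact Submodule.subset_span ⟨s, rfl⟩
    · rw [thetaF_X]
      simp [emb, Fintype.linearCombination_apply, smul_eq_C_mul]
  have core : ∀ (m : ℕ) (x : MvPolynomial (Fin r) A),
      thetaF (fun i q => g q i) (X s) ^ m * x ∈ reesAlg A r M → x ∈ reesAlg A r M := by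
    intro m x hx
    rw [hR] at hx ⊢
    exact core_mem (fun i q => g q i) hr d hd0 hn (cols_exist M k hk g hg) rs hrs
      hreg.toIsWeaklyRegular hrl s m x hx
  constructor
  · apply le_antisymm
    · rintro x ⟨m, hm⟩
      refine core m x ?_
      have hmem : thetaF (fun i q => g q i) (X s) ∈ reesAlg A r M := Algebra.subset_adjoin hfs
      have hpos : (⟨_, hmem⟩ : reesAlg A r M) ∈ posPart A r (reesAlg A r M) := by
        refine RingHom.mem_ker.2 ?_
        show constantCoeff (thetaF (fun i q => g q i) (X s)) = 0
        rw [thetaF_X]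
        simp
      have := hm _ (Ideal.pow_mem_pow hpos m)
      rw [SubmonoidClass.coe_pow] at this
      exact this
    · intro x hx
      exact ⟨0, fun y _ => mul_mem y.2 hx⟩
  · have hpow : ∀ m : ℕ, sub1 A r M ^ m ≤ Subalgebra.toSubmodule (reesAlg A r M) := by
      intro m
      induction m with
      | zero =>
        rw [pow_zero, Submodule.one_le]
        exact one_mem (reesAlg A r M)
      | succ m ih =>
        rw [pow_succ, Submodule.mul_le]
        intro y hy z hz
        exact mul_mem (S := Subalgebra A (MvPolynomial (Fin r) A)) (ih hy)
          (Algebra.subset_adjoin hz)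
    apply le_antisymm
    · refine iSup_le fun l => ?_
      rintro x ⟨⟨v, -, rfl⟩, hx⟩
      refine ⟨v, rees_lin A r M v ?_, rfl⟩
      refine core (l + 1) _ ?_
      rw [mul_comm]
      exact hpow (l + 2) (Submodule.mem_div_iff_forall_mul_mem.1 hx _
        (Submodule.pow_mem_pow _ hfs (l + 1)))
    · refine le_trans ?_ (le_iSup _ 0)
      refine le_inf (Submodule.map_mono le_top) ?_
      intro x hx
      rw [Submodule.mem_div_iff_forall_mul_mem]
      intro y hy
      rw [pow_succ']
      exact Submodule.mul_mem_mul hx hy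
end

section
/- Let A be a Noetherian ring and M a finitely generated A-module contained in a free A-module F of finite rank r > 0. Let L = A x_1 + A x_2 + ⋯ + A x_ℓ ⊆ M be an A-submodule of M which is a reduction of M. Then tilde(M) = ⋃_{n>0} [M^{n+1} :_F (A x_1^n + A x_2^n + ⋯ + A x_ℓ^n)], where the powers x_i^n are taken in the Rees algebra R(M). -/
set_option maxHeartbeats 1000000
set_option synthInstance.maxHeartbeats 400000

open MvPolynomial IsLocalRing

theorem rr_aux_pow_le {A S : Type} [CommRing A] [CommRing S] [Algebra A S]
    (N : Submodule A S) (l : ℕ) (y : Fin l → S) (hy : ∀ i, y i ∈ N) (n k : ℕ)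
    (hk : l * n < k) (hnk : n + 1 ≤ k) :
    (Submodule.span A (Set.range y)) ^ k ≤
      Submodule.span A (Set.range fun i => y i ^ (n + 1)) * N ^ (k - (n + 1)) := by
  rw [Submodule.span_pow, Submodule.span_le]
  intro a ha
  rw [Set.mem_pow] at ha
  obtain ⟨f, rfl⟩ := ha
  choose g hg using fun j => (f j).2
  rw [List.prod_ofFn]
  obtain ⟨i, hi⟩ := Fintype.exists_lt_card_fiber_of_mul_lt_card (f := g) (n := n)
    (by simpa using hk)
  obtain ⟨T, hT, hTc⟩ := Finset.exists_subset_card_eq (Nat.succ_le_of_lt hi)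
  rw [← Finset.prod_mul_prod_compl T]
  refine Submodule.mul_mem_mul ?_ ?_
  · have : ∏ j ∈ T, (f j : S) = y i ^ (n + 1) := by
      rw [Finset.prod_eq_pow_card (b := y i), hTc]
      intro j hj
      have := hT hj
      simp only [Finset.mem_filter, Finset.mem_univ, true_and] at this
      rw [← hg j, this]
    rw [this]
    exact Submodule.subset_span ⟨i, rfl⟩
  · have hc : Tᶜ.card = k - (n + 1) := by
      rw [Finset.card_compl, hTc, Fintype.card_fin]
    rw [← hc]
    have key : ∀ U : Finset (Fin k), ∏ j ∈ U, (f j : S) ∈ N ^ U.card := by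
      intro U
      classical
      induction U using Finset.induction_on with
      | empty => simpa using ⟨(1 : A), map_one (algebraMap A S)⟩
      | insert j U hj ih =>
        rw [Finset.prod_insert hj, Finset.card_insert_of_notMem hj, pow_succ']
        refine Submodule.mul_mem_mul ?_ ih
        rw [← hg j]
        exact hy _
    exact key _

/-- Proposition 3.12. Let `A` be a Noetherian ring and `M` a finitely
generated `A`-module contained in a free module `F` of finite rank `r > 0`. Let
`L = A x₁ + ⋯ + A x_ℓ ⊆ M` be an `A`-submodule of `M` which is a reduction of `M`
(i.e. `M^{s+1} = L M^s` for some `s ≥ 0`, products computed in `R(M) ⊆ S`). Then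
`widetilde{M} = ⋃_{n>0} [M^{n+1} :_F (A x₁ⁿ + A x₂ⁿ + ⋯ + A x_ℓⁿ)]`, the powers `xᵢⁿ`
being taken in the Rees algebra. -/
theorem ratliffRush_statement_7 (A : Type) [CommRing A] [IsNoetherianRing A]
    (r : ℕ) (hr : 0 < r) (M : Submodule A (Fin r → A))
    (ℓ : ℕ) (x : Fin ℓ → (Fin r → A)) (hxM : ∀ i, x i ∈ M)
    (hred : ∃ s : ℕ, (sub1 A r M) ^ (s + 1)
      = sub1 A r (Submodule.span A (Set.range x)) * (sub1 A r M) ^ s) :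
    ratliffRush A r (freeSub A r) (sub1 A r M)
      = ⨆ n : ℕ, ((freeSub A r) ⊓
          ((sub1 A r M) ^ (n + 2) /
            Submodule.span A (Set.range fun i => (emb A r (x i)) ^ (n + 1)))) := by
  obtain ⟨s, hs⟩ := hred
  have hyN : ∀ i, emb A r (x i) ∈ sub1 A r M := fun i => Submodule.mem_map_of_mem (hxM i)
  have hL : sub1 A r (Submodule.span A (Set.range x))
      = Submodule.span A (Set.range fun i => emb A r (x i)) := by
    rw [sub1, Submodule.map_span, ← Set.range_comp]
    rfl
  rw [hL] at hs
  unfold ratliffRush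
  generalize hN : sub1 A r M = N at *
  apply le_antisymm
  · refine iSup_mono fun n => inf_le_inf_left _ ?_
    intro f hf
    rw [Submodule.mem_div_iff_forall_mul_mem] at hf ⊢
    intro z hz
    refine hf z (Submodule.span_le.2 ?_ hz)
    rintro _ ⟨i, rfl⟩
    exact Submodule.pow_mem_pow _ (hyN i) _
  · refine iSup_le fun n => ?_
    have hpow : ∀ k, N ^ (s + k)
        = (Submodule.span A (Set.range fun i => emb A r (x i))) ^ k * N ^ s := by
      intro k
      induction k with
      | zero => simp
      | succ k ih =>
        rw [← add_assoc, pow_succ, ih, mul_assoc, ← pow_succ, hs, ← mul_assoc, ← pow_succ]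
    set k := ℓ * n + n + 1 with hk
    refine le_trans (inf_le_inf_left _ ?_) 
      (le_iSup (fun m : ℕ => freeSub A r ⊓ (N ^ (m + 2) / N ^ (m + 1))) (s + (ℓ * n + n)))
    intro f hf
    have hle := rr_aux_pow_le N ℓ (fun i => emb A r (x i)) hyN n k (by omega) (by omega)
    have h1 : Submodule.span A {f} *
        Submodule.span A (Set.range fun i => emb A r (x i) ^ (n + 1)) ≤ N ^ (n + 2) := by
      rw [← Submodule.le_div_iff_mul_le, Submodule.span_le]
      simpa using hf
    rw [← Submodule.span_singleton_le_iff_mem, Submodule.le_div_iff_mul_le]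
    have e : s + (ℓ * n + n) + 1 = s + k := by omega
    have e2 : s + (ℓ * n + n) + 2 = (n + 2) + (k - (n + 1)) + s := by omega
    rw [e, hpow, e2, pow_add N (n + 2 + (k - (n + 1))) s, pow_add N (n + 2) (k - (n + 1)), ← mul_assoc]
    refine mul_le_mul' ?_ (le_refl (N ^ s))
    refine (mul_le_mul' le_rfl hle).trans ?_
    rw [← mul_assoc]
    exact mul_le_mul' h1 le_rfl
end

section
/- Let A be a Noetherian ring and M a finitely generated A-module contained in a free A-module F of finite rank r > 0. If L is an A-submodule of M which is a reduction of M, then tilde(L) ⊆ tilde(M). -/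
set_option maxHeartbeats 1000000
set_option synthInstance.maxHeartbeats 400000

open MvPolynomial IsLocalRing

/-- Corollary after Proposition 3.12. Let `A` be a Noetherian ring and
`M` a finitely generated `A`-module contained in a free module `F` of finite rank
`r > 0`. If `L` is an `A`-submodule of `M` which is a reduction of `M` (i.e.
`M^{s+1} = L·M^s` for some `s ≥ 0`, products computed inside `R(M) ⊆ S`), then
`widetilde{L} ⊆ widetilde{M}`. -/
theorem ratliffRush_statement_8 (A : Type) [CommRing A] [IsNoetherianRing A]
    (r : ℕ) (hr : 0 < r) (L M : Submodule A (Fin r → A)) (hLM : L ≤ M)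
    (hred : ∃ s : ℕ, (sub1 A r M) ^ (s + 1) = sub1 A r L * (sub1 A r M) ^ s) :
    ratliffRush A r (freeSub A r) (sub1 A r L)
      ≤ ratliffRush A r (freeSub A r) (sub1 A r M) := by
  obtain ⟨s, hs⟩ := hred
  have hle : sub1 A r L ≤ sub1 A r M := Submodule.map_mono hLM
  unfold ratliffRush
  generalize sub1 A r L = P at *
  generalize sub1 A r M = Q at *
  have key : ∀ k : ℕ, Q ^ (k + s) = P ^ k * Q ^ s := by
    intro k
    induction k with
    | zero => simp
    | succ k ih =>
      calc Q ^ (k + 1 + s) = Q ^ (k + s) * Q := by rw [← pow_succ]; congr 1; omega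
        _ = P ^ k * Q ^ (s + 1) := by rw [ih, mul_assoc, pow_succ Q s]
        _ = P ^ (k + 1) * Q ^ s := by rw [hs, ← mul_assoc, pow_succ P k]
  refine iSup_le fun l => le_trans ?_ (le_iSup _ (l + s))
  refine inf_le_inf le_rfl ?_
  rw [Submodule.le_div_iff_mul_le]
  have h0 : (P ^ (l + 2) / P ^ (l + 1)) * P ^ (l + 1) ≤ P ^ (l + 2) :=
    Submodule.le_div_iff_mul_le.mp le_rfl
  rw [show l + s + 1 = (l + 1) + s by omega, show l + s + 2 = (l + 2) + s by omega,
    key, key, ← mul_assoc]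
  exact mul_le_mul' h0 le_rfl
end

section
/- Let A be a Noetherian ring and M a finitely generated faithful A-module contained in a free A-module F of finite rank r > 0. Then tilde(M^n) = (tilde(M))^n = M^n for every sufficiently large integer n. -/
set_option maxHeartbeats 1000000
set_option synthInstance.maxHeartbeats 400000

open MvPolynomial IsLocalRing

/-- A form of McCoy's theorem for a set of multivariate polynomials. -/
theorem mccoy_aux {A : Type} [CommRing A] {r : ℕ} (P : Set (MvPolynomial (Fin r) A)) :
    ∀ k : ℕ, ∀ f : MvPolynomial (Fin r) A, f.support.card = k → f ≠ 0 →
      (∀ g ∈ P, f * g = 0) → ∃ c : A, c ≠ 0 ∧ ∀ g ∈ P, C c * g = 0 := by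
  classical
  intro k
  induction k using Nat.strong_induction_on with
  | _ k ih =>
  intro f hk hf hP
  by_cases hall : ∀ g ∈ P, ∀ d, C (coeff d g) * f = 0
  · obtain ⟨d, hd⟩ := MvPolynomial.ne_zero_iff.mp hf
    refine ⟨coeff d f, hd, fun g hg => ?_⟩
    ext e
    have := congrArg (coeff d) (hall g hg e)
    rw [coeff_C_mul] at this ⊢
    rw [mul_comm]; simpa using this
  · push Not at hall
    obtain ⟨g, hg, d0, hd0⟩ := hall
    let m : MonomialOrder (Fin r) := MonomialOrder.lex
    set h : MvPolynomial (Fin r) A :=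
      ∑ d ∈ g.support with C (coeff d g) * f ≠ 0, monomial d (coeff d g) with hh
    have hcoeff : ∀ d, coeff d h = if C (coeff d g) * f ≠ 0 then coeff d g else 0 := by
      intro d
      rw [hh, coeff_sum]
      simp only [coeff_monomial]
      rw [Finset.sum_ite_eq']
      by_cases h1 : C (coeff d g) * f ≠ 0
      · have : coeff d g ≠ 0 := by rintro h0; simp [h0] at h1
        simp [h1, this]
      · simp [h1]
    have hfh : f * h = 0 := by
      have e1 : f * g = 0 := hP g hg
      have e2 : f * h = f * g := by
        conv_rhs => rw [← MvPolynomial.support_sum_monomial_coeff g]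
        rw [hh, Finset.mul_sum, Finset.mul_sum, Finset.sum_filter]
        refine Finset.sum_congr rfl fun d _ => ?_
        split_ifs with h1
        · rfl
        · push Not at h1
          rw [← mul_one (coeff d g), ← C_mul_monomial, ← mul_assoc, mul_comm f, h1, zero_mul]
      rw [e2, e1]
    have hne : h ≠ 0 := by
      intro h0
      have := hcoeff d0
      rw [h0, if_pos hd0] at this
      rw [← this] at hd0
      simp at hd0
    have hlc : coeff (m.degree h) h ≠ 0 := by
      have := (m.leadingCoeff_ne_zero_iff (f := h)).mpr hne
      exact this
    set d := m.degree h with hd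
    have hd1 : C (coeff d g) * f ≠ 0 := by
      intro h1
      apply hlc
      rw [hcoeff, if_neg (by simpa using h1)]
    have hd2 : coeff d h = coeff d g := by rw [hcoeff, if_pos hd1]
    have hz : coeff (m.degree f) f * coeff d g = 0 := by
      rw [← hd2]
      have := m.coeff_mul_of_degree_add (f := f) (g := h)
      rw [hfh, coeff_zero] at this
      exact this.symm
    have hfl : coeff (m.degree f) f ≠ 0 := (m.leadingCoeff_ne_zero_iff (f := f)).mpr hf
    refine ih _ ?_ (C (coeff d g) * f) rfl hd1 (fun q hq => by rw [mul_assoc, hP q hq, mul_zero])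
    rw [← hk]
    apply Finset.card_lt_card
    rw [Finset.ssubset_iff_of_subset]
    · refine ⟨m.degree f, by simpa using hfl, ?_⟩
      rw [mem_support_iff, coeff_C_mul, mul_comm, hz]
      simp
    · intro e he
      rw [mem_support_iff, coeff_C_mul] at he
      rw [mem_support_iff]
      intro h0; simp [h0] at he

theorem ann_sub1 {A : Type} [CommRing A] {r : ℕ} {M : Submodule A (Fin r → A)}
    (hfaith : faithfulSub A r M) (f : MvPolynomial (Fin r) A)
    (hf : ∀ g ∈ sub1 A r M, f * g = 0) : f = 0 := by
  classical
  by_contra h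
  obtain ⟨c, hc, hcP⟩ := mccoy_aux (sub1 A r M : Set _) _ f rfl h hf
  apply hc
  apply hfaith
  intro x hx
  have h1 := hcP (emb A r x) (Submodule.mem_map_of_mem hx)
  funext i
  have h2 := congrArg (coeff (Finsupp.single i 1)) h1
  rw [coeff_C_mul] at h2
  simpa [emb, Fintype.linearCombination_apply, coeff_sum, coeff_X, Finsupp.single_left_inj] using h2

theorem freeSub_hom (A : Type) [CommRing A] (r : ℕ) (n : ℕ) :
    (freeSub A r) ^ n ≤ homogeneousSubmodule (Fin r) A n := by
  induction n with
  | zero =>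
    rw [pow_zero, Submodule.one_le]
    exact isHomogeneous_one _ _
  | succ n ih =>
    rw [pow_succ]
    refine (mul_le_mul' ih ?_).trans (homogeneousSubmodule_mul n 1)
    rintro _ ⟨x, -, rfl⟩
    rw [Fintype.linearCombination_apply]
    exact Submodule.sum_mem _ fun i _ => Submodule.smul_mem _ _ (isHomogeneous_X _ _)

theorem sub1_le (A : Type) [CommRing A] (r : ℕ) (M : Submodule A (Fin r → A)) :
    sub1 A r M ≤ freeSub A r := Submodule.map_mono le_top

theorem hc_mul_mem {A : Type} [CommRing A] {r : ℕ}
    (P Q T : ℕ → Submodule A (MvPolynomial (Fin r) A))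
    (hPQ : ∀ i j, P i * Q j ≤ T (i + j)) (x y : MvPolynomial (Fin r) A)
    (hx : ∀ i, homogeneousComponent i x ∈ P i) (hy : ∀ i, homogeneousComponent i y ∈ Q i)
    (n : ℕ) : homogeneousComponent n (x * y) ∈ T n := by
  have e : x * y = ∑ i ∈ Finset.range (x.totalDegree + 1), ∑ j ∈ Finset.range (y.totalDegree + 1),
      homogeneousComponent i x * homogeneousComponent j y := by
    rw [← Finset.sum_mul_sum, sum_homogeneousComponent, sum_homogeneousComponent]
  rw [e, map_sum]
  refine Submodule.sum_mem _ fun i _ => ?_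
  rw [map_sum]
  refine Submodule.sum_mem _ fun j _ => ?_
  rw [homogeneousComponent_of_mem (n := i + j) (homogeneousSubmodule_mul i j
    (Submodule.mul_mem_mul (homogeneousComponent_mem i x) (homogeneousComponent_mem j y)))]
  split_ifs with h
  · subst h; exact hPQ _ _ (Submodule.mul_mem_mul (hx i) (hy j))
  · exact zero_mem _

theorem hc_mul_one {A : Type} [CommRing A] {r : ℕ} (x y : MvPolynomial (Fin r) A)
    (hy : y ∈ homogeneousSubmodule (Fin r) A 1) (n : ℕ) :
    homogeneousComponent (n + 1) (x * y) = homogeneousComponent n x * y := by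
  have e : x * y = ∑ i ∈ Finset.range (x.totalDegree + 1), homogeneousComponent i x * y := by
    rw [← Finset.sum_mul, sum_homogeneousComponent]
  rw [e, map_sum]
  have : ∀ i, homogeneousComponent (n + 1) (homogeneousComponent i x * y)
      = if n = i then homogeneousComponent i x * y else 0 := by
    intro i
    rw [homogeneousComponent_of_mem (n := i + 1) (homogeneousSubmodule_mul i 1
      (Submodule.mul_mem_mul (homogeneousComponent_mem i x) hy))]
    simp
  simp only [this]
  rw [Finset.sum_ite_eq]
  split_ifs with h
  · rfl
  · rw [homogeneousComponent_eq_zero, zero_mul]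
    simpa using h

theorem hc_rees {A : Type} [CommRing A] {r : ℕ} (M : Submodule A (Fin r → A))
    (x : MvPolynomial (Fin r) A) (hx : x ∈ reesAlg A r M) :
    ∀ n, homogeneousComponent n x ∈ (sub1 A r M) ^ n := by
  induction hx using Algebra.adjoin_induction with
  | mem x hx =>
    intro n
    have : x ∈ homogeneousSubmodule (Fin r) A 1 := by
      have := freeSub_hom A r 1
      rw [pow_one] at this
      exact this (sub1_le A r M hx)
    rw [homogeneousComponent_of_mem this]
    split_ifs with h
    · subst h; simpa using hx
    · exact zero_mem _
  | algebraMap a =>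
    intro n
    have : algebraMap A (MvPolynomial (Fin r) A) a ∈ homogeneousSubmodule (Fin r) A 0 :=
      isHomogeneous_C _ _
    rw [homogeneousComponent_of_mem this]
    split_ifs with h
    · subst h; rw [pow_zero]; exact Submodule.algebraMap_mem a
    · exact zero_mem _
  | add x y _ _ hx hy =>
    intro n
    rw [map_add]; exact add_mem (hx n) (hy n)
  | mul x y _ _ hx hy =>
    exact hc_mul_mem _ _ _ (fun i j => (pow_add _ i j).ge) x y hx hy

theorem sub1_fg {A : Type} [CommRing A] [IsNoetherianRing A] {r : ℕ}
    (M : Submodule A (Fin r → A)) : (sub1 A r M).FG :=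
  (IsNoetherian.noetherian M).map _

/-- The submodule `R :_S M` of `S` over the Rees algebra `R`. -/
noncomputable def colonRees (A : Type) [CommRing A] (r : ℕ) (M : Submodule A (Fin r → A)) :
    Submodule (reesAlg A r M) (MvPolynomial (Fin r) A) where
  carrier := {x | ∀ a ∈ sub1 A r M, x * a ∈ reesAlg A r M}
  add_mem' := by
    intro x y hx hy a ha
    rw [add_mul]; exact add_mem (hx a ha) (hy a ha)
  zero_mem' := by
    intro a _; rw [zero_mul]; exact zero_mem _
  smul_mem' := by
    intro c x hx a ha
    rw [Subalgebra.smul_def, smul_eq_mul, mul_assoc]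
    exact mul_mem c.2 (hx a ha)

theorem colonRees_fg {A : Type} [CommRing A] [IsNoetherianRing A] {r : ℕ}
    {M : Submodule A (Fin r → A)} (hfaith : faithfulSub A r M) : (colonRees A r M).FG := by
  classical
  obtain ⟨s, hs⟩ := sub1_fg M
  have hadj : reesAlg A r M = Algebra.adjoin A (s : Set (MvPolynomial (Fin r) A)) := by
    rw [reesAlg, ← hs, Algebra.adjoin_span]
  have hN : IsNoetherianRing (reesAlg A r M) := by
    rw [hadj]
    have : Algebra.FiniteType A (Algebra.adjoin A (s : Set (MvPolynomial (Fin r) A))) :=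
      (Subalgebra.fg_iff_finiteType _).mp ⟨s, rfl⟩
    exact Algebra.FiniteType.isNoetherianRing A _
  have hmem : ∀ a : s, (a : MvPolynomial (Fin r) A) ∈ sub1 A r M := fun a => by
    rw [← hs]; exact Submodule.subset_span a.2
  let φ : colonRees A r M →ₗ[reesAlg A r M] (s → reesAlg A r M) :=
    { toFun := fun b a => ⟨b.1 * a.1, b.2 a.1 (hmem a)⟩
      map_add' := fun x y => by
        funext a; apply Subtype.ext; simp [add_mul]
      map_smul' := fun c x => by
        funext a; apply Subtype.ext; simp [Subalgebra.smul_def, mul_assoc] }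
  have hφ : Function.Injective φ := by
    intro b c hbc
    apply Subtype.ext
    rw [← sub_eq_zero]
    apply ann_sub1 hfaith
    intro g hg
    rw [← hs] at hg
    induction hg using Submodule.span_induction with
    | mem a ha =>
      rw [sub_mul, sub_eq_zero]
      exact congrArg Subtype.val (congrFun hbc ⟨a, ha⟩)
    | zero => simp
    | add x y _ _ hx hy => rw [mul_add, hx, hy, add_zero]
    | smul c x _ hx => rw [mul_smul_comm, hx, smul_zero]
  have : IsNoetherian (reesAlg A r M) (colonRees A r M) := isNoetherian_of_injective φ hφ
  exact (Submodule.fg_top _).mp (IsNoetherian.noetherian _)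

theorem pow_le_rees {A : Type} [CommRing A] {r : ℕ} (M : Submodule A (Fin r → A)) (n : ℕ) :
    (sub1 A r M) ^ n ≤ Subalgebra.toSubmodule (reesAlg A r M) := by
  induction n with
  | zero => rw [pow_zero, Submodule.one_le]; exact one_mem (reesAlg A r M)
  | succ n ih =>
    rw [pow_succ, Submodule.mul_le]
    intro x hx y hy
    exact mul_mem (S := Subalgebra A _) (s := reesAlg A r M) (ih hx) (Algebra.subset_adjoin hy)

theorem colon_one {A : Type} [CommRing A] [IsNoetherianRing A] {r : ℕ}
    {M : Submodule A (Fin r → A)} (hfaith : faithfulSub A r M) :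
    ∃ D : ℕ, ∀ n, D < n → ∀ x ∈ (freeSub A r) ^ n,
      (∀ a ∈ sub1 A r M, x * a ∈ (sub1 A r M) ^ (n + 1)) → x ∈ (sub1 A r M) ^ n := by
  obtain ⟨s, hs⟩ := colonRees_fg hfaith
  refine ⟨s.sup totalDegree, fun n hn x hx hxa => ?_⟩
  set D := s.sup totalDegree with hD
  have hxB : x ∈ colonRees A r M := fun a ha => pow_le_rees M _ (hxa a ha)
  set N := sub1 A r M with hN
  let Q : ℕ → Submodule A (MvPolynomial (Fin r) A) := fun j => if D < j then ⊥ else N ^ (j + 1) / N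
  let T : ℕ → Submodule A (MvPolynomial (Fin r) A) := fun j => if D < j then N ^ j else ⊤
  have hPQ : ∀ i j, N ^ i * Q j ≤ T (i + j) := by
    intro i j
    by_cases h1 : D < i + j
    · by_cases h2 : D < j
      · simp [Q, h2]
      · obtain ⟨k, rfl⟩ : ∃ k, i = k + 1 := ⟨i - 1, by omega⟩
        simp only [Q, T, h1, h2, if_true, if_false]
        rw [pow_succ, mul_assoc, show k + 1 + j = k + (j + 1) by ring, pow_add N k]
        refine mul_le_mul' le_rfl ?_
        rw [mul_comm]
        exact Submodule.le_div_iff_mul_le.mp le_rfl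
    · simp [T, h1]
  have hsB : ∀ b ∈ s, b ∈ colonRees A r M := fun b hb => by
    rw [← hs]; exact Submodule.subset_span hb
  have hone : ∀ a ∈ N, a ∈ homogeneousSubmodule (Fin r) A 1 := fun a ha => by
    have := freeSub_hom A r 1
    rw [pow_one] at this
    exact this (sub1_le A r M ha)
  have hQ : ∀ b ∈ s, ∀ j, homogeneousComponent j b ∈ Q j := by
    intro b hb j
    by_cases h : D < j
    · rw [homogeneousComponent_eq_zero]
      · exact zero_mem _
      · exact lt_of_le_of_lt (Finset.le_sup (f := totalDegree) hb) h
    · simp only [Q, h, if_false]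
      rw [Submodule.mem_div_iff_forall_mul_mem]
      intro a ha
      rw [← hc_mul_one b a (hone a ha)]
      exact hc_rees M _ (hsB b hb a ha) _
  have key : homogeneousComponent n x ∈ T n := by
    rw [← hs, Submodule.mem_span_finset] at hxB
    obtain ⟨f, -, hf⟩ := hxB
    rw [← hf, map_sum]
    refine Submodule.sum_mem _ fun b hb => ?_
    rw [Subalgebra.smul_def, smul_eq_mul]
    exact hc_mul_mem _ Q T hPQ _ _ (hc_rees M _ (f b).2) (hQ b hb) n
  rw [homogeneousComponent_eq_self (freeSub_hom A r n hx)] at key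
  simpa [T, hn] using key

theorem colon_pow {A : Type} [CommRing A] [IsNoetherianRing A] {r : ℕ}
    {M : Submodule A (Fin r → A)} (hfaith : faithfulSub A r M) :
    ∃ D : ℕ, ∀ n, D < n → ∀ k, ∀ x ∈ (freeSub A r) ^ n,
      (∀ a ∈ (sub1 A r M) ^ k, x * a ∈ (sub1 A r M) ^ (n + k)) → x ∈ (sub1 A r M) ^ n := by
  obtain ⟨D, hD⟩ := colon_one hfaith
  refine ⟨D, fun n hn k => ?_⟩
  induction k with
  | zero =>
    intro x _ h
    simpa using h 1 (by rw [pow_zero]; exact Submodule.one_le.mp le_rfl)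
  | succ k ih =>
    intro x hx h
    refine ih x hx fun a ha => hD (n + k) (by omega) _ ?_ fun b hb => ?_
    · rw [pow_add]
      exact Submodule.mul_mem_mul hx (pow_le_pow_left' (sub1_le A r M) k ha)
    · rw [mul_assoc]
      exact h _ (by rw [pow_succ]; exact Submodule.mul_mem_mul ha hb)

/-- The degree-`n` part of the Ratliff-Rush closure of the Rees algebra. -/
noncomputable def rrDeg (A : Type) [CommRing A] (r : ℕ) (M : Submodule A (Fin r → A)) (n : ℕ) :
    Submodule A (MvPolynomial (Fin r) A) :=
  ⨆ k : ℕ, ((freeSub A r) ^ n ⊓ ((sub1 A r M) ^ (n + k) / (sub1 A r M) ^ k))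

theorem rrDeg_mul (A : Type) [CommRing A] (r : ℕ) (M : Submodule A (Fin r → A)) (m n : ℕ) :
    rrDeg A r M m * rrDeg A r M n ≤ rrDeg A r M (m + n) := by
  unfold rrDeg
  rw [Submodule.iSup_mul]
  refine iSup_le fun k => ?_
  rw [Submodule.mul_iSup]
  refine iSup_le fun l => ?_
  refine le_iSup_of_le (k + l) (le_inf ?_ ?_)
  · rw [pow_add (freeSub A r)]; apply mul_le_mul' <;> exact inf_le_left
  · rw [Submodule.le_div_iff_mul_le, pow_add _ k l, mul_mul_mul_comm,
      show m + n + (k + l) = (m + k) + (n + l) by ring, pow_add _ (m + k)]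
    exact mul_le_mul' (Submodule.le_div_iff_mul_le.mp inf_le_right)
      (Submodule.le_div_iff_mul_le.mp inf_le_right)

theorem rrDeg_pow (A : Type) [CommRing A] (r : ℕ) (M : Submodule A (Fin r → A)) (n : ℕ) :
    (rrDeg A r M 1) ^ n ≤ rrDeg A r M n := by
  induction n with
  | zero =>
    rw [pow_zero]
    refine le_iSup_of_le 0 (le_inf (by simp) ?_)
    rw [Submodule.le_div_iff_mul_le]; simp
  | succ n ih =>
    rw [pow_succ]
    exact (mul_le_mul' ih le_rfl).trans (rrDeg_mul A r M n 1)

theorem ratliffRush_le (A : Type) [CommRing A] (r : ℕ) (M : Submodule A (Fin r → A)) (n : ℕ) :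
    ratliffRush A r ((freeSub A r) ^ n) ((sub1 A r M) ^ n) ≤ rrDeg A r M n := by
  refine iSup_le fun l => ?_
  rw [← pow_mul, ← pow_mul, show n * (l + 2) = n + n * (l + 1) by ring]
  exact le_iSup (fun k => (freeSub A r) ^ n ⊓ ((sub1 A r M) ^ (n + k) / (sub1 A r M) ^ k)) _

theorem le_ratliffRush (A : Type) [CommRing A] (r : ℕ)
    (Fn N : Submodule A (MvPolynomial (Fin r) A)) (h : N ≤ Fn) :
    N ≤ ratliffRush A r Fn N := by
  refine le_iSup_of_le 0 (le_inf h ?_)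
  rw [Submodule.le_div_iff_mul_le, ← pow_succ']

/-- Proposition 3.15 (1). Let `A` be a Noetherian ring and `M` a
finitely generated faithful `A`-module contained in a free module `F` of finite rank
`r > 0`. Then `widetilde{M^n} = (widetilde{M})^n = M^n` for every sufficiently large
integer `n`. -/
theorem ratliffRush_statement_9 (A : Type) [CommRing A] [IsNoetherianRing A]
    (r : ℕ) (hr : 0 < r) (M : Submodule A (Fin r → A))
    (hfaith : faithfulSub A r M) :
    ∀ᶠ n : ℕ in Filter.atTop,
      ratliffRush A r ((freeSub A r) ^ n) ((sub1 A r M) ^ n)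
        = (ratliffRush A r (freeSub A r) (sub1 A r M)) ^ n ∧
      (ratliffRush A r (freeSub A r) (sub1 A r M)) ^ n = (sub1 A r M) ^ n := by
  obtain ⟨D, hD⟩ := colon_pow hfaith
  filter_upwards [Filter.eventually_gt_atTop D] with n hn
  have h1 : rrDeg A r M n ≤ (sub1 A r M) ^ n := by
    refine iSup_le fun k x hx => ?_
    exact hD n hn k x hx.1 (Submodule.mem_div_iff_forall_mul_mem.mp hx.2)
  have h2 : (ratliffRush A r (freeSub A r) (sub1 A r M)) ^ n = (sub1 A r M) ^ n := by
    apply le_antisymm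
    · have h := ratliffRush_le A r M 1
      rw [pow_one, pow_one] at h
      exact ((pow_le_pow_left' h n).trans (rrDeg_pow A r M n)).trans h1
    · exact pow_le_pow_left' (le_ratliffRush A r _ _ (sub1_le A r M)) n
  refine ⟨?_, h2⟩
  rw [h2]
  exact le_antisymm ((ratliffRush_le A r M n).trans h1)
    (le_ratliffRush A r _ _ (pow_le_pow_left' (sub1_le A r M) n))
end

section
/- Let A be a Noetherian ring, M a finitely generated faithful A-module contained in a free A-module F of finite rank r > 0, and N an A-submodule of F with M ⊆ N. Then the following are equivalent: (i) N ⊆ tilde(M); (ii) M^ℓ = N^ℓ for some ℓ > 0; (iii) M^n = N^n for every n ≫ 0; (iv) tilde(M) = tilde(N). Here powers are taken inside S = Sym_A(F). -/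
set_option maxHeartbeats 1000000
set_option synthInstance.maxHeartbeats 400000

open MvPolynomial IsLocalRing

section RRaux
variable {A S : Type} [CommRing A] [CommRing S] [Algebra A S]

theorem rr_mul_le_r {P Q R : Submodule A S} (h : P ≤ Q) : R * P ≤ R * Q :=
  mul_le_mul' le_rfl h

theorem rr_mul_le_l {P Q R : Submodule A S} (h : P ≤ Q) : P * R ≤ Q * R :=
  mul_le_mul' h le_rfl

theorem rr_prod_aux {d : ℕ} (M : Submodule A S) (x : S) (a b : Fin d → S)
    (ha : ∀ i, a i = x ∨ a i = 0) (hb : ∀ i, b i ∈ M) (s : Finset (Fin d)) :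
    (∏ i ∈ s, a i ∈ (M ⊔ Submodule.span A {x}) ^ s.card) ∧
    (∏ i ∈ s, (a i + b i) - ∏ i ∈ s, a i) * x ∈
      M * (M ⊔ Submodule.span A {x}) ^ s.card := by
  classical
  set P := M ⊔ Submodule.span A {x} with hP
  have hx : x ∈ P := Submodule.mem_sup_right (Submodule.mem_span_singleton_self x)
  have haP : ∀ i, a i ∈ P := fun i => by
    rcases ha i with h | h <;> rw [h]
    · exact hx
    · exact zero_mem _
  have hbP : ∀ i, b i ∈ P := fun i => Submodule.mem_sup_left (hb i)
  induction s using Finset.induction_on with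
  | empty => simp [Submodule.one_le.mp le_rfl]
  | insert i s hi ih =>
    rw [Finset.prod_insert hi, Finset.prod_insert hi, Finset.card_insert_of_notMem hi]
    refine ⟨?_, ?_⟩
    · rw [pow_succ']
      exact Submodule.mul_mem_mul (haP i) ih.1
    · have e : ((a i + b i) * ∏ i ∈ s, (a i + b i) - a i * ∏ i ∈ s, a i) * x =
          ((∏ i ∈ s, (a i + b i) - ∏ i ∈ s, a i) * x) * (a i + b i)
            + b i * ((∏ i ∈ s, a i) * x) := by ring
      rw [e]
      refine add_mem ?_ ?_
      · rw [pow_succ, ← mul_assoc]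
        exact Submodule.mul_mem_mul ih.2 (add_mem (haP i) (hbP i))
      · rw [pow_succ]
        exact Submodule.mul_mem_mul (hb i) (Submodule.mul_mem_mul ih.1 hx)

theorem rr_det_aux {d : ℕ} (M : Submodule A S) (x : S) (B : Matrix (Fin d) (Fin d) S)
    (hB : ∀ i j, B i j ∈ M) :
    ((Matrix.scalar (Fin d) x + B).det - x ^ d) * x ∈
      M * (M ⊔ Submodule.span A {x}) ^ d := by
  classical
  have h1 : x ^ d = (Matrix.scalar (Fin d) x).det := by simp
  rw [h1, Matrix.det_apply', Matrix.det_apply', ← Finset.sum_sub_distrib, Finset.sum_mul]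
  refine Submodule.sum_mem _ fun σ _ => ?_
  have h2 := (rr_prod_aux M x (fun i => Matrix.scalar (Fin d) x (σ i) i)
    (fun i => B (σ i) i) (fun i => by
      by_cases h : σ i = i <;> simp [Matrix.scalar_apply, Matrix.diagonal_apply, h])
    (fun i => hB _ _) Finset.univ).2
  rw [Finset.card_univ, Fintype.card_fin] at h2
  rw [← mul_sub, mul_assoc]
  simp only [Matrix.add_apply]
  rcases Int.units_eq_one_or (Equiv.Perm.sign σ) with h | h
  · rw [h]; simpa using h2
  · rw [h]
    have := neg_mem h2
    simpa using this

theorem rr_cancel_pow (M : Submodule A S)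
    (hf : ∀ s : S, (∀ m ∈ M, m * s = 0) → s = 0) (l : ℕ) :
    ∀ s : S, (∀ m ∈ M ^ l, m * s = 0) → s = 0 := by
  induction l with
  | zero =>
    intro s h
    simpa using h 1 (by simp [Submodule.one_le.mp le_rfl])
  | succ l ih =>
    intro s h
    refine ih s fun m hm => hf _ fun y hy => ?_
    rw [← mul_assoc, mul_comm y m]
    exact h _ (by rw [pow_succ]; exact Submodule.mul_mem_mul hm hy)

theorem rr_integral (M : Submodule A S) (hM : M.FG)
    (hf : ∀ s : S, (∀ m ∈ M, m * s = 0) → s = 0) (x : S) (l : ℕ)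
    (hx : ∀ m ∈ M ^ l, x * m ∈ M ^ (l + 1)) :
    ∃ d : ℕ, x ^ (d + 1) ∈ M * (M ⊔ Submodule.span A {x}) ^ d := by
  classical
  obtain ⟨d, g, hg⟩ := Submodule.fg_iff_exists_fin_generating_family.1 (hM.pow l)
  refine ⟨d, ?_⟩
  have hgm : ∀ i, g i ∈ M ^ l := fun i => hg ▸ Submodule.subset_span ⟨i, rfl⟩
  -- elements of `M * M ^ l` are combinations of the generators with coefficients in `M`
  have key : ∀ y ∈ M * M ^ l, ∃ c : Fin d → S, (∀ j, c j ∈ M) ∧ y = ∑ j, c j * g j := by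
    intro y hy
    refine Submodule.mul_induction_on hy (fun m hm n hn => ?_) ?_
    · rw [← hg, Submodule.mem_span_range_iff_exists_fun] at hn
      obtain ⟨c, rfl⟩ := hn
      refine ⟨fun j => c j • m, fun j => M.smul_mem _ hm, ?_⟩
      rw [Finset.mul_sum]
      exact Finset.sum_congr rfl fun j _ => by simp
    · rintro y z ⟨c, hc, rfl⟩ ⟨c', hc', rfl⟩
      exact ⟨fun j => c j + c' j, fun j => add_mem (hc j) (hc' j), by
        simp [add_mul, Finset.sum_add_distrib]⟩
  have h0 : ∀ i, ∃ c : Fin d → S, (∀ j, c j ∈ M) ∧ x * g i = ∑ j, c j * g j := fun i =>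
    key _ (by rw [← pow_succ']; exact hx _ (hgm i))
  choose c hc hxg using h0
  let B : Matrix (Fin d) (Fin d) S := fun i j => - c i j
  set D := Matrix.scalar (Fin d) x + B with hD
  have hker : D.mulVec g = 0 := by
    funext i
    rw [hD, Matrix.add_mulVec, Pi.add_apply, Pi.zero_apply]
    have : (Matrix.scalar (Fin d) x).mulVec g i = x * g i := by
      simp [Matrix.scalar_apply, Matrix.mulVec_diagonal]
    rw [this, hxg i]
    simp [Matrix.mulVec, dotProduct, B]
  have hdet : ∀ i, D.det * g i = 0 := by
    have h := congrArg (D.adjugate.mulVec) hker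
    rw [Matrix.mulVec_mulVec, Matrix.adjugate_mul, Matrix.mulVec_zero] at h
    intro i
    have := congrFun h i
    simpa [Matrix.smul_mulVec] using this
  have hD0 : D.det = 0 := by
    refine rr_cancel_pow M hf l _ fun m hm => ?_
    rw [← hg, Submodule.mem_span_range_iff_exists_fun] at hm
    obtain ⟨c, rfl⟩ := hm
    rw [Finset.sum_mul]
    refine Finset.sum_eq_zero fun i _ => ?_
    rw [smul_mul_assoc, mul_comm, hdet, smul_zero]
  have := rr_det_aux M x B (fun i j => neg_mem (hc i j))
  rw [← hD, hD0, zero_sub, neg_mul] at this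
  rw [pow_succ]
  exact neg_mem_iff.mp this

theorem rr_step (M X : Submodule A S) (k : ℕ) :
    (M ⊔ X) ^ (k + 1) ≤ M * (M ⊔ X) ^ k ⊔ X ^ (k + 1) := by
  induction k with
  | zero => simp
  | succ k ih =>
    calc (M ⊔ X) ^ (k + 1 + 1) = M * (M ⊔ X) ^ (k + 1) ⊔ X * (M ⊔ X) ^ (k + 1) := by
          rw [pow_succ', Submodule.sup_mul]
      _ ≤ _ := by
          refine sup_le le_sup_left ?_
          refine (rr_mul_le_r ih).trans ?_
          rw [Submodule.mul_sup]
          refine sup_le (le_sup_of_le_left ?_) (le_sup_of_le_right ?_)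
          · calc X * (M * (M ⊔ X) ^ k) = M * (X * (M ⊔ X) ^ k) := by ring
              _ ≤ M * ((M ⊔ X) * (M ⊔ X) ^ k) :=
                rr_mul_le_r (rr_mul_le_l le_sup_right)
              _ = _ := by rw [← pow_succ']
          · rw [← pow_succ']

theorem rr_colon_pow (M N : Submodule A S) (l : ℕ) (h : N * M ^ l ≤ M ^ (l + 1)) (k : ℕ) :
    N ^ k * M ^ l ≤ M ^ (l + k) := by
  induction k with
  | zero => simp
  | succ k ih =>
    calc N ^ (k + 1) * M ^ l = N * (N ^ k * M ^ l) := by ring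
      _ ≤ N * M ^ (l + k) := rr_mul_le_r ih
      _ = (N * M ^ l) * M ^ k := by ring
      _ ≤ M ^ (l + 1) * M ^ k := rr_mul_le_l h
      _ = _ := by ring

theorem rr_colon_mono (M N : Submodule A S) (l : ℕ) (h : N * M ^ l ≤ M ^ (l + 1)) (k : ℕ) :
    N * M ^ (l + k) ≤ M ^ (l + k + 1) := by
  calc N * M ^ (l + k) = (N * M ^ l) * M ^ k := by ring
      _ ≤ M ^ (l + 1) * M ^ k := rr_mul_le_l h
      _ = _ := by ring

theorem rr_eq_of_le (M N : Submodule A S) (hMN : M ≤ N) (l : ℕ)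
    (h : M ^ (l + 1) = N ^ (l + 1)) (k : ℕ) : M ^ (l + 1 + k) = N ^ (l + 1 + k) := by
  induction k with
  | zero => exact h
  | succ k ih =>
    refine le_antisymm (pow_le_pow_left' hMN _) ?_
    calc N ^ (l + 1 + (k + 1)) = N * N ^ (l + 1 + k) := by ring
      _ = (N * M ^ (l + k)) * M := by rw [← ih]; ring
      _ ≤ (N * N ^ (l + k)) * M :=
        rr_mul_le_l (rr_mul_le_r (pow_le_pow_left' hMN _))
      _ = N ^ (l + 1 + k) * M := by ring
      _ = M ^ (l + 1 + (k + 1)) := by rw [← ih]; ring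

theorem rr_single (M : Submodule A S) (hM : M.FG)
    (hf : ∀ s : S, (∀ m ∈ M, m * s = 0) → s = 0) (x : S) (l : ℕ)
    (hx : Submodule.span A {x} * M ^ l ≤ M ^ (l + 1)) :
    ∃ n : ℕ, M ^ (n + 1) = (M ⊔ Submodule.span A {x}) ^ (n + 1) := by
  have hx' := rr_colon_mono _ _ _ hx 1
  obtain ⟨d, hd⟩ := rr_integral M hM hf x (l + 1) (fun m hm =>
    hx' (Submodule.mul_mem_mul (Submodule.mem_span_singleton_self x) hm))
  set P := M ⊔ Submodule.span A {x} with hP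
  have h1 : P ^ (d + 1) ≤ M * P ^ d := by
    refine (rr_step M _ d).trans (sup_le le_rfl ?_)
    rw [Submodule.span_pow, Set.singleton_pow, Submodule.span_singleton_le_iff_mem]
    exact hd
  have h2 : ∀ k, P ^ (d + k) ≤ M ^ k * P ^ d := by
    intro k
    induction k with
    | zero => simp
    | succ k ih =>
      calc P ^ (d + (k + 1)) = P * P ^ (d + k) := by ring
        _ ≤ P * (M ^ k * P ^ d) := rr_mul_le_r ih
        _ = M ^ k * P ^ (d + 1) := by ring
        _ ≤ M ^ k * (M * P ^ d) := rr_mul_le_r h1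
        _ = _ := by ring
  refine ⟨d + l, le_antisymm (pow_le_pow_left' le_sup_left _) ?_⟩
  have h3 : P * M ^ (l + 1) ≤ M ^ (l + 1 + 1) := by
    rw [hP, Submodule.sup_mul, pow_succ' M (l + 1)]
    refine sup_le le_rfl ?_
    rw [← pow_succ']
    exact hx'
  have h4 := rr_colon_pow _ _ _ h3 d
  calc P ^ (d + l + 1) ≤ M ^ (l + 1) * P ^ d := h2 (l + 1)
    _ = P ^ d * M ^ (l + 1) := mul_comm _ _
    _ ≤ M ^ (l + 1 + d) := h4
    _ = _ := by ring

theorem rr_multi (N : Submodule A S) (hN : N.FG) :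
    ∀ (M : Submodule A S), M.FG → (∀ s : S, (∀ m ∈ M, m * s = 0) → s = 0) →
    ∀ l : ℕ, N * M ^ l ≤ M ^ (l + 1) → ∃ n : ℕ, M ^ (n + 1) = (M ⊔ N) ^ (n + 1) := by
  induction N, hN using Submodule.fg_induction with
  | singleton x =>
    intro M hM hf l h
    exact rr_single M hM hf x l h
  | sup N₁ N₂ h₁ h₂ ih₁ ih₂ =>
    intro M hM hf l h
    rw [Submodule.sup_mul] at h
    obtain ⟨n, hn⟩ := ih₁ M hM hf l (le_sup_left.trans h)
    have e := rr_eq_of_le M _ le_sup_left n hn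
    have hl := rr_colon_mono _ _ _ (le_sup_right.trans h) (n + 1)
    obtain ⟨k, hk⟩ := ih₂ (M ⊔ N₁) (hM.sup h₁)
      (fun s hs => hf s fun m hm => hs m (Submodule.mem_sup_left hm)) (n + 1 + l) (by
        rw [← e l, add_assoc (n + 1), ← e, add_comm (n + 1) l, ← add_assoc (n + 1),
          add_comm (n + 1) l]
        exact hl)
    have e' := rr_eq_of_le _ _ le_sup_left k hk
    refine ⟨n + (k + 1), ?_⟩
    rw [← sup_assoc]
    calc M ^ (n + (k + 1) + 1) = M ^ (n + 1 + (k + 1)) := by ring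
      _ = (M ⊔ N₁) ^ (n + 1 + (k + 1)) := e _
      _ = (M ⊔ N₁) ^ (k + 1 + (n + 1)) := by ring
      _ = _ := e' _
      _ = _ := by ring

end RRaux

theorem rr_faithful (A : Type) [CommRing A] (r : ℕ) (M : Submodule A (Fin r → A))
    (hfaith : faithfulSub A r M) (n : ℕ) : ∀ s : MvPolynomial (Fin r) A, s.support.card ≤ n →
    (∀ m ∈ M, emb A r m * s = 0) → s = 0 := by
  classical
  induction n with
  | zero =>
    intro s hs _
    simpa using hs
  | succ n ih =>
    intro s hs hk
    by_contra hs0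
    obtain ⟨e, he, hmax⟩ := Finset.exists_max_image s.support (fun v => toLex v)
      (by simpa [Finset.nonempty_iff_ne_empty] using hs0)
    have key : ∀ m ∈ M, ∀ i : Fin r, C (m i) * s = 0 := by
      intro m hm i
      induction i using WellFoundedLT.induction with
      | ind i ihi =>
      have hlc : m i * s.coeff e = 0 := by
        have h := congrArg (coeff (Finsupp.single i 1 + e)) (hk m hm)
        rw [Fintype.linearCombination_apply, Finset.sum_mul, coeff_sum,
          Finset.sum_eq_single i] at h
        · simpa [MvPolynomial.coeff_X_mul] using h
        · intro j _ hji
          rw [smul_mul_assoc]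
          rcases lt_or_gt_of_ne hji with h' | h'
          · have := ihi j h'
            rw [mul_comm (X j), ← smul_mul_assoc, smul_eq_C_mul, this]
            simp
          · rw [coeff_smul, coeff_X_mul']
            split_ifs with hj
            · have hc : s.coeff (Finsupp.single i 1 + e - Finsupp.single j 1) = 0 := by
                by_contra hc
                have h1 := hmax _ (mem_support_iff.mpr hc)
                refine absurd h1 (not_le.mpr ?_)
                have h2 : (Finsupp.single i 1 + e - Finsupp.single j 1) + Finsupp.single j 1
                    = Finsupp.single i 1 + e := by
                  refine tsub_add_cancel_of_le ?_
                  rw [Finsupp.single_le_iff]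
                  exact Nat.one_le_iff_ne_zero.mpr (Finsupp.mem_support_iff.mp hj)
                have h3 : toLex (Finsupp.single j 1 : Fin r →₀ ℕ) < toLex (Finsupp.single i 1) := by
                  exact Finsupp.Lex.single_strictAnti h'
                have h4 : toLex e + toLex (Finsupp.single j 1 : Fin r →₀ ℕ) <
                    toLex (Finsupp.single i 1 + e - Finsupp.single j 1)
                      + toLex (Finsupp.single j 1 : Fin r →₀ ℕ) := by
                  rw [← toLex_add, ← toLex_add, h2, add_comm, toLex_add, toLex_add]
                  exact add_lt_add_left h3 _
                exact lt_of_add_lt_add_right h4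
              rw [hc, smul_zero]
            · simp
        · simp
      refine ih _ ?_ fun m' hm' => ?_
      · have hsub : (C (m i) * s).support ⊆ s.support.erase e := by
          intro v hv
          rw [mem_support_iff, coeff_C_mul] at hv
          rw [Finset.mem_erase, mem_support_iff]
          refine ⟨?_, fun h => hv (by rw [h, mul_zero])⟩
          rintro rfl
          exact hv hlc
        have := Finset.card_le_card hsub
        rw [Finset.card_erase_of_mem he] at this
        omega
      · rw [mul_left_comm, hk m' hm', mul_zero]
    refine mem_support_iff.mp he (hfaith _ fun m hm => ?_)
    funext i
    have := congrArg (coeff e) (key m hm i)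
    rw [coeff_C_mul] at this
    simpa [mul_comm] using this

theorem rr_colon_monotone {A : Type} [CommRing A] {r : ℕ}
    (F M : Submodule A (MvPolynomial (Fin r) A)) :
    Monotone fun l : ℕ => F ⊓ (M ^ (l + 2) / M ^ (l + 1)) := by
  refine monotone_nat_of_le_succ fun l => inf_le_inf_left _ ?_
  rw [Submodule.le_div_iff_mul_le]
  exact rr_colon_mono M _ (l + 1) (Submodule.le_div_iff_mul_le.mp le_rfl) 1

/-- Proposition 3.15 (2). Let `A` be a Noetherian ring, `M` a finitely
generated faithful `A`-module contained in a free module `F` of finite rank `r > 0`, and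
`N` an `A`-submodule of `F` with `M ⊆ N`. Then the following are equivalent:
(i) `N ⊆ widetilde{M}`; (ii) `M^ℓ = N^ℓ` for some `ℓ > 0`; (iii) `M^n = N^n` for every
`n ≫ 0`; (iv) `widetilde{M} = widetilde{N}`. Powers are taken inside `S = Sym_A(F)`. -/
theorem ratliffRush_statement_10 (A : Type) [CommRing A] [IsNoetherianRing A]
    (r : ℕ) (hr : 0 < r) (M N : Submodule A (Fin r → A)) (hMN : M ≤ N)
    (hfaith : faithfulSub A r M) :
    List.TFAE [
      sub1 A r N ≤ ratliffRush A r (freeSub A r) (sub1 A r M),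
      ∃ ℓ : ℕ, 0 < ℓ ∧ (sub1 A r M) ^ ℓ = (sub1 A r N) ^ ℓ,
      ∀ᶠ n : ℕ in Filter.atTop, (sub1 A r M) ^ n = (sub1 A r N) ^ n,
      ratliffRush A r (freeSub A r) (sub1 A r M)
        = ratliffRush A r (freeSub A r) (sub1 A r N)] := by
  have hle : sub1 A r M ≤ sub1 A r N := Submodule.map_mono hMN
  have hMfg : (sub1 A r M).FG := (IsNoetherian.noetherian M).map _
  have hNfg : (sub1 A r N).FG := (IsNoetherian.noetherian N).map _
  have hNF : sub1 A r N ≤ freeSub A r := Submodule.map_mono le_top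
  have hf : ∀ s, (∀ m ∈ sub1 A r M, m * s = 0) → s = 0 := fun s hs =>
    rr_faithful A r M hfaith _ s le_rfl fun m hm => hs _ (Submodule.mem_map_of_mem hm)
  generalize sub1 A r M = P at *
  generalize sub1 A r N = Q at *
  generalize freeSub A r = F at *
  tfae_have 1 → 2 := by
    intro h
    have hc := (CompleteLattice.isCompactElement_iff_le_of_directed_sSup_le _ Q).mp
      ((Submodule.fg_iff_compact Q).mp hNfg)
    obtain ⟨_, ⟨l, rfl⟩, hl⟩ := hc (Set.range fun l : ℕ => F ⊓ (P ^ (l + 2) / P ^ (l + 1)))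
      (Set.range_nonempty _) (directedOn_range.mpr (rr_colon_monotone F P).directed_le) h
    obtain ⟨n, hn⟩ := rr_multi Q hNfg P hMfg hf (l + 1)
      (Submodule.le_div_iff_mul_le.mp (hl.trans inf_le_right))
    rw [sup_eq_right.mpr hle] at hn
    exact ⟨n + 1, Nat.succ_pos _, hn⟩
  tfae_have 2 → 3 := by
    rintro ⟨l, hl, h⟩
    obtain ⟨l, rfl⟩ := Nat.exists_eq_succ_of_ne_zero hl.ne'
    refine Filter.eventually_atTop.mpr ⟨l + 1, fun n hn => ?_⟩
    obtain ⟨k, rfl⟩ := Nat.exists_eq_add_of_le hn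
    exact rr_eq_of_le P Q hle l h k
  tfae_have 3 → 4 := by
    intro h
    obtain ⟨n, hn⟩ := Filter.eventually_atTop.mp h
    unfold ratliffRush
    refine le_antisymm (iSup_le fun l => ?_) (iSup_le fun l => ?_)
    · refine (rr_colon_monotone F P (Nat.le_add_right l n)).trans ?_
      refine le_iSup_of_le (l + n) ?_
      simp only
      rw [hn (l + n + 2) (by omega), hn (l + n + 1) (by omega)]
    · refine (rr_colon_monotone F Q (Nat.le_add_right l n)).trans ?_
      refine le_iSup_of_le (l + n) ?_
      simp only
      rw [hn (l + n + 2) (by omega), hn (l + n + 1) (by omega)]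
  tfae_have 4 → 1 := by
    intro h
    rw [h]
    unfold ratliffRush
    refine le_iSup_of_le 0 (le_inf hNF ?_)
    rw [Submodule.le_div_iff_mul_le, ← pow_succ']
  tfae_finish
end

section
/- Let A be a Noetherian ring and M a finitely generated faithful A-module contained in a free A-module F of finite rank r > 0. Then the Ratliff–Rush closure tilde(M) is itself Ratliff–Rush closed: tilde(tilde(M)) = tilde(M). -/
set_option maxHeartbeats 1000000
set_option synthInstance.maxHeartbeats 400000

open MvPolynomial IsLocalRing

theorem rr_mono_step {A S : Type} [CommRing A] [CommRing S] [Algebra A S]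
    (Fn N : Submodule A S) :
    Monotone (fun l : ℕ => Fn ⊓ (N ^ (l + 2) / N ^ (l + 1))) := by
  refine monotone_nat_of_le_succ fun l => ?_
  refine inf_le_inf_left _ ?_
  rw [Submodule.le_div_iff_mul_le]
  have h : (N ^ (l + 2) / N ^ (l + 1)) * N ^ (l + 1) ≤ N ^ (l + 2) :=
    Submodule.le_div_iff_mul_le.1 le_rfl
  calc (N ^ (l + 2) / N ^ (l + 1)) * N ^ (l + 1 + 1)
      = ((N ^ (l + 2) / N ^ (l + 1)) * N ^ (l + 1)) * N := by rw [pow_succ N (l + 1), mul_assoc]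
    _ ≤ N ^ (l + 2) * N := by gcongr
    _ = N ^ (l + 1 + 2) := by rw [← pow_succ]

/-- Proposition 3.15 (3). Let `A` be a Noetherian ring and `M` a
finitely generated faithful `A`-module contained in a free module `F` of finite rank
`r > 0`. Then the Ratliff--Rush closure `widetilde{M}` is itself Ratliff--Rush closed:
`widetilde{widetilde{M}} = widetilde{M}`. -/
theorem ratliffRush_statement_11 (A : Type) [CommRing A] [IsNoetherianRing A]
    (r : ℕ) (hr : 0 < r) (M : Submodule A (Fin r → A))
    (hfaith : faithfulSub A r M) :
    ratliffRush A r (freeSub A r) (ratliffRush A r (freeSub A r) (sub1 A r M))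
      = ratliffRush A r (freeSub A r) (sub1 A r M) := by
  set F := freeSub A r with hF
  set N := sub1 A r M with hN
  have hNF : N ≤ F := Submodule.map_mono le_top
  set T := ratliffRush A r F N with hT
  have hTF : T ≤ F := iSup_le fun l => inf_le_left
  have hFfg : F.FG := Module.Finite.fg_top.map _
  have hNT : N ≤ T := by
    refine le_trans (le_inf hNF ?_) (le_iSup (fun l : ℕ => F ⊓ (N ^ (l + 2) / N ^ (l + 1))) 0)
    rw [Submodule.le_div_iff_mul_le, ← pow_succ']
  have hTT : T ≤ ratliffRush A r F T := by
    refine le_trans (le_inf hTF ?_) (le_iSup (fun l : ℕ => F ⊓ (T ^ (l + 2) / T ^ (l + 1))) 0)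
    rw [Submodule.le_div_iff_mul_le, ← pow_succ']
  have hTfg : T.FG := by
    have : IsNoetherian A F := isNoetherian_of_fg_of_noetherian F hFfg
    have := IsNoetherian.noetherian (T.comap F.subtype)
    have h2 := this.map F.subtype
    rwa [Submodule.map_comap_subtype, inf_eq_right.2 hTF] at h2
  -- the union stabilizes
  obtain ⟨k, hk⟩ : ∃ k : ℕ, T ≤ F ⊓ (N ^ (k + 2) / N ^ (k + 1)) := by
    have hc := (Submodule.fg_iff_compact T).1 hTfg
    rw [CompleteLattice.isCompactElement_iff_le_of_directed_sSup_le] at hc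
    obtain ⟨_, ⟨k, rfl⟩, hk⟩ := hc (Set.range fun l : ℕ => F ⊓ (N ^ (l + 2) / N ^ (l + 1)))
      (Set.range_nonempty _) ((rr_mono_step F N).directed_le.directedOn_range) le_rfl
    exact ⟨k, hk⟩
  have h1 : T * N ^ (k + 1) ≤ N ^ (k + 2) :=
    Submodule.le_div_iff_mul_le.1 (hk.trans inf_le_right)
  have h2 : ∀ n : ℕ, T ^ n * N ^ (k + 1) ≤ N ^ (n + k + 1) := by
    intro n
    induction n with
    | zero => simp
    | succ n ih =>
      calc T ^ (n + 1) * N ^ (k + 1) = T ^ n * (T * N ^ (k + 1)) := by rw [pow_succ, mul_assoc]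
        _ ≤ T ^ n * N ^ (k + 2) := by gcongr
        _ = T ^ n * N ^ (k + 1) * N := by rw [pow_succ N (k + 1), mul_assoc]
        _ ≤ N ^ (n + k + 1) * N := by gcongr
        _ = N ^ (n + 1 + k + 1) := by rw [← pow_succ]; congr 1; ring
  refine le_antisymm (iSup_le fun l => ?_) hTT
  refine le_trans (inf_le_inf_left F ?_) (le_iSup (fun l : ℕ => F ⊓ (N ^ (l + 2) / N ^ (l + 1))) (l + k + 1))
  rw [Submodule.le_div_iff_mul_le]
  have h3 : (T ^ (l + 2) / T ^ (l + 1)) * T ^ (l + 1) ≤ T ^ (l + 2) :=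
    Submodule.le_div_iff_mul_le.1 le_rfl
  calc (T ^ (l + 2) / T ^ (l + 1)) * N ^ (l + k + 1 + 1)
      = (T ^ (l + 2) / T ^ (l + 1)) * (N ^ (l + 1) * N ^ (k + 1)) := by
        rw [← pow_add]; congr 2; ring
    _ ≤ (T ^ (l + 2) / T ^ (l + 1)) * (T ^ (l + 1) * N ^ (k + 1)) := by gcongr
    _ = (T ^ (l + 2) / T ^ (l + 1)) * T ^ (l + 1) * N ^ (k + 1) := by rw [mul_assoc]
    _ ≤ T ^ (l + 2) * N ^ (k + 1) := by gcongr
    _ ≤ N ^ (l + 2 + k + 1) := h2 _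
    _ = N ^ (l + k + 1 + 2) := by congr 1; ring
end
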